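/- arXiv:2512.16566 — 3 statements merged into one kernel-verified Lean document; each statement's English description precedes it below -/
import Mathlib

section
/- Let N be a positive integer and let p ≥ q > 1/3 with p > (q+1)/(3q−1) and N < 2αz₀ + 2. Then the Lane–Emden system (LE) admits no positive solution (u,v) ∈ C²(ℝ^N) × C²(ℝ^N) that is stable in every bounded open subset of ℝ^N. -/
open MeasureTheory Metric Set

noncomputable section

/-- Euclidean space `ℝ^N`. -/
abbrev Euc (N : ℕ) := EuclideanSpace ℝ (Fin N)

/-- The Laplacian of a function `f : ℝ^N → ℝ`, as the sum of the pure second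
partial derivatives. -/
def lap {N : ℕ} (f : Euc N → ℝ) (x : Euc N) : ℝ :=
  ∑ i : Fin N, iteratedFDeriv ℝ 2 f x ![EuclideanSpace.single i 1, EuclideanSpace.single i 1]

/-- `(u, v)` is a solution of the Hénon–Lane–Emden system
`-Δu = |x|^a |v|^{p-1} v`, `-Δv = |x|^b |u|^{q-1} u` on `ℝ^N \ {0}`:
`u, v` are `C²` on `ℝ^N \ {0}`, continuous on `ℝ^N`, and satisfy the equations pointwise. -/
def IsHLESol {N : ℕ} (p q a b : ℝ) (u v : Euc N → ℝ) : Prop :=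
  ContDiffOn ℝ 2 u {x : Euc N | x ≠ 0} ∧ ContDiffOn ℝ 2 v {x : Euc N | x ≠ 0} ∧
  Continuous u ∧ Continuous v ∧
  (∀ x : Euc N, x ≠ 0 → -lap u x = ‖x‖ ^ a * (|v x| ^ (p - 1) * v x)) ∧
  (∀ x : Euc N, x ≠ 0 → -lap v x = ‖x‖ ^ b * (|u x| ^ (q - 1) * u x))

/-- Stability of a (positive) solution of the Hénon–Lane–Emden system on an open set `Ω`:
there exist positive `C²` functions `ξ, ζ` on `Ω` with
`-Δξ ≥ p |x|^a v^{p-1} ζ` and `-Δζ ≥ q |x|^b u^{q-1} ξ` on `Ω`. -/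
def HLEStableOn {N : ℕ} (p q a b : ℝ) (u v : Euc N → ℝ) (Ω : Set (Euc N)) : Prop :=
  ∃ ξ ζ : Euc N → ℝ, ContDiffOn ℝ 2 ξ Ω ∧ ContDiffOn ℝ 2 ζ Ω ∧
    (∀ x ∈ Ω, 0 < ξ x) ∧ (∀ x ∈ Ω, 0 < ζ x) ∧
    (∀ x ∈ Ω, p * ‖x‖ ^ a * v x ^ (p - 1) * ζ x ≤ -lap ξ x) ∧
    (∀ x ∈ Ω, q * ‖x‖ ^ b * u x ^ (q - 1) * ξ x ≤ -lap ζ x)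

/-- Stability outside a compact set `K`: stability on every open set whose closure is
compact and contained in `ℝ^N \ K`. -/
def HLEStableOutside {N : ℕ} (p q a b : ℝ) (u v : Euc N → ℝ) (K : Set (Euc N)) : Prop :=
  IsCompact K ∧
    ∀ Ω : Set (Euc N), IsOpen Ω → IsCompact (closure Ω) → closure Ω ⊆ Kᶜ →
      HLEStableOn p q a b u v Ω

/-- `(u, v)` solves the Lane–Emden system `-Δu = |v|^{p-1} v`, `-Δv = |u|^{q-1} u` on `ℝ^N`. -/
def IsLESol {N : ℕ} (p q : ℝ) (u v : Euc N → ℝ) : Prop :=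
  (∀ x : Euc N, -lap u x = |v x| ^ (p - 1) * v x) ∧
  (∀ x : Euc N, -lap v x = |u x| ^ (q - 1) * u x)

/-- Stability of a (positive) solution of the Lane–Emden system on an open set `Ω`. -/
def LEStableOn {N : ℕ} (p q : ℝ) (u v : Euc N → ℝ) (Ω : Set (Euc N)) : Prop :=
  ∃ ξ ζ : Euc N → ℝ, ContDiffOn ℝ 2 ξ Ω ∧ ContDiffOn ℝ 2 ζ Ω ∧
    (∀ x ∈ Ω, 0 < ξ x) ∧ (∀ x ∈ Ω, 0 < ζ x) ∧
    (∀ x ∈ Ω, p * v x ^ (p - 1) * ζ x ≤ -lap ξ x) ∧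
    (∀ x ∈ Ω, q * u x ^ (q - 1) * ξ x ≤ -lap ζ x)

/-- A function on `ℝ^N` is polynomially bounded. -/
def PolyBounded {N : ℕ} (w : Euc N → ℝ) : Prop :=
  ∃ K L R : ℝ, 0 < K ∧ 0 < L ∧ ∀ x : Euc N, R ≤ ‖x‖ → |w x| ≤ K * ‖x‖ ^ L

/-- The polynomial `G` from Theorem 1.4 (iii). -/
def Gpoly (p q x : ℝ) : ℝ :=
  x ^ 4 - (4 * p * q * (q + 1) / (p + 1)) * x ^ 2 +
    (2 * p * q * (q + 1) * (p + q + 2) / (p + 1) ^ 2) * x -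
    p * q * (q + 1) ^ 2 / (p + 1) ^ 2

section Auxiliary

/-- The partial derivative of `f` in the `i`-th coordinate direction. -/
def pd {N : ℕ} (i : Fin N) (f : Euc N → ℝ) (x : Euc N) : ℝ :=
  fderiv ℝ f x (EuclideanSpace.single i 1)

/-- The squared length of the gradient of `f`. -/
def gradSq {N : ℕ} (f : Euc N → ℝ) (x : Euc N) : ℝ := ∑ i, pd i f x ^ 2

variable {N : ℕ}

lemma gradSq_nonneg (f : Euc N → ℝ) (x : Euc N) : 0 ≤ gradSq f x :=
  Finset.sum_nonneg fun _ _ => sq_nonneg _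

lemma lap_eq_sum_pd_pd {f : Euc N → ℝ} {x : Euc N} (hf : ContDiffAt ℝ 2 f x) :
    lap f x = ∑ i, pd i (pd i f) x := by
  have h1 : DifferentiableAt ℝ (fderiv ℝ f) x :=
    (hf.fderiv_right (m := 1) (by norm_num)).differentiableAt one_ne_zero
  refine Finset.sum_congr rfl fun i _ => ?_
  rw [iteratedFDeriv_two_apply]
  change _ = fderiv ℝ (fun y => fderiv ℝ f y (EuclideanSpace.single i 1)) x _
  rw [fderiv_clm_apply h1 (differentiableAt_const _)]
  simp

lemma contDiffOn_pd {f : Euc N → ℝ} {Ω : Set (Euc N)} (hΩ : IsOpen Ω) {n m : ℕ∞}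
    (hf : ContDiffOn ℝ n f Ω) (hmn : m + 1 ≤ n) (i : Fin N) : ContDiffOn ℝ m (pd i f) Ω := by
  have := hf.fderiv_of_isOpen hΩ (m := m) (by exact_mod_cast hmn)
  exact this.clm_apply contDiffOn_const

lemma continuous_pd {f : Euc N → ℝ} (hf : ContDiff ℝ 1 f) (i : Fin N) : Continuous (pd i f) :=
  (hf.continuous_fderiv one_ne_zero).clm_apply continuous_const

lemma continuous_gradSq {f : Euc N → ℝ} (hf : ContDiff ℝ 1 f) : Continuous (gradSq f) :=
  continuous_finsetSum _ fun i _ => (continuous_pd hf i).pow 2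

lemma tsupport_pd_subset (f : Euc N → ℝ) (i : Fin N) : tsupport (pd i f) ⊆ tsupport f :=
  tsupport_fderiv_apply_subset ℝ _

lemma pd_eq_zero {f : Euc N → ℝ} {x : Euc N} (hx : x ∉ tsupport f) (i : Fin N) : pd i f x = 0 :=
  image_eq_zero_of_notMem_tsupport fun h => hx (tsupport_pd_subset f i h)

lemma gradSq_eq_zero {f : Euc N → ℝ} {x : Euc N} (hx : x ∉ tsupport f) : gradSq f x = 0 := by
  simp [gradSq, pd_eq_zero hx]

lemma integrable_of_eq_zero_off {F θ : Euc N → ℝ} (hF : Continuous F) (hc : HasCompactSupport θ)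
    (h : ∀ x, x ∉ tsupport θ → F x = 0) : Integrable F := by
  refine hF.integrable_of_hasCompactSupport (hc.of_isClosed_subset (isClosed_tsupport _) ?_)
  refine closure_minimal (fun x hx => ?_) (isClosed_tsupport _)
  by_contra h'
  exact hx (h x h')

lemma integrable_gradSq {f : Euc N → ℝ} (hf : ContDiff ℝ 1 f) (hc : HasCompactSupport f) :
    Integrable (gradSq f) :=
  integrable_of_eq_zero_off (continuous_gradSq hf) hc fun _ hx => gradSq_eq_zero hx

lemma continuousOn_lap {w : Euc N → ℝ} {Ω : Set (Euc N)} (hΩ : IsOpen Ω)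
    (hw : ContDiffOn ℝ 2 w Ω) : ContinuousOn (lap w) Ω := by
  have h : ContinuousOn (fun x => ∑ i, pd i (pd i w) x) Ω := by
    refine continuousOn_finsetSum _ fun i _ => ?_
    have h1 := contDiffOn_pd hΩ (n := 2) (m := 1) hw (by norm_num) i
    exact (contDiffOn_pd hΩ (n := 1) (m := 0) h1 (by norm_num) i).continuousOn
  exact h.congr fun x hx => lap_eq_sum_pd_pd (hw.contDiffAt (hΩ.mem_nhds hx))

lemma continuous_mul_of_tsupport_subset {F θ : Euc N → ℝ} {Ω : Set (Euc N)} (hΩ : IsOpen Ω)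
    (hF : ContinuousOn F Ω) (hθ : Continuous θ) (hs : tsupport θ ⊆ Ω) :
    Continuous fun x => F x * θ x :=
  (hF.mul hθ.continuousOn).continuous_of_tsupport_subset hΩ
    ((tsupport_mul_subset_right (f := F) (g := θ)).trans hs)

/-- Weak form of `-Δw`, tested against `C¹` functions with compact support in `Ω`. -/
lemma integral_neg_lap_mul {w θ : Euc N → ℝ} {Ω : Set (Euc N)} (hΩ : IsOpen Ω)
    (hw : ContDiffOn ℝ 2 w Ω) (hθ : ContDiff ℝ 1 θ) (hc : HasCompactSupport θ)
    (hs : tsupport θ ⊆ Ω) :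
    Integrable (fun x => -lap w x * θ x) ∧
    Integrable (fun x => ∑ i, pd i w x * pd i θ x) ∧
    ∫ x, -lap w x * θ x = ∫ x, ∑ i, pd i w x * pd i θ x := by
  have hw1 : ∀ i, ContDiffOn ℝ 1 (pd i w) Ω := fun i =>
    contDiffOn_pd hΩ (n := 2) (m := 1) hw (by norm_num) i
  have hw2 : ∀ i, ContinuousOn (pd i (pd i w)) Ω := fun i =>
    (contDiffOn_pd hΩ (n := 1) (m := 0) (hw1 i) (by norm_num) i).continuousOn
  have i1 : ∀ i, Integrable fun x => pd i w x * pd i θ x := fun i =>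
    integrable_of_eq_zero_off (continuous_mul_of_tsupport_subset hΩ (hw1 i).continuousOn
      (continuous_pd hθ i) ((tsupport_pd_subset θ i).trans hs)) hc
      fun x hx => by simp [pd_eq_zero hx]
  have i2 : ∀ i, Integrable fun x => pd i (pd i w) x * θ x := fun i =>
    integrable_of_eq_zero_off (continuous_mul_of_tsupport_subset hΩ (hw2 i) hθ.continuous hs) hc
      fun x hx => by simp [image_eq_zero_of_notMem_tsupport hx]
  have i3 : ∀ i, Integrable fun x => pd i w x * θ x := fun i =>
    integrable_of_eq_zero_off (continuous_mul_of_tsupport_subset hΩ (hw1 i).continuousOn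
      hθ.continuous hs) hc fun x hx => by simp [image_eq_zero_of_notMem_tsupport hx]
  have key : ∀ i, ∫ x, pd i w x * pd i θ x = -∫ x, pd i (pd i w) x * θ x := fun i =>
    integral_mul_fderiv_eq_neg_fderiv_mul_of_integrable (i2 i) (i1 i) (i3 i)
      (fun x hx => ((hw1 i).contDiffAt (hΩ.mem_nhds (hs hx))).differentiableAt one_ne_zero)
      (fun x _ => hθ.differentiable one_ne_zero x)
  have e : (fun x => -lap w x * θ x) = fun x => ∑ i, -(pd i (pd i w) x * θ x) := by
    ext x
    by_cases hx : x ∈ tsupport θ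
    · rw [lap_eq_sum_pd_pd (hw.contDiffAt (hΩ.mem_nhds (hs hx))), Finset.sum_neg_distrib,
        neg_mul, Finset.sum_mul]
    · simp [image_eq_zero_of_notMem_tsupport hx]
  refine ⟨?_, integrable_finsetSum _ fun i _ => i1 i, ?_⟩
  · rw [e]
    exact integrable_finsetSum _ fun i _ => (i2 i).neg
  · rw [e, integral_finsetSum (f := fun i x => -(pd i (pd i w) x * θ x)) _ fun i _ => (i2 i).neg,
      integral_finsetSum _ fun i _ => i1 i]
    exact Finset.sum_congr rfl fun i _ => by rw [key i, integral_neg]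

lemma pd_mul {f g : Euc N → ℝ} {x : Euc N} (hf : DifferentiableAt ℝ f x)
    (hg : DifferentiableAt ℝ g x) (i : Fin N) :
    pd i (fun y => f y * g y) x = pd i f x * g x + f x * pd i g x := by
  simp only [pd]
  rw [fderiv_fun_mul hf hg]
  simp [mul_comm]
  ring

lemma pd_comp {f : Euc N → ℝ} {F : ℝ → ℝ} {F' : ℝ} {x : Euc N} (hF : HasDerivAt F F' (f x))
    (hf : DifferentiableAt ℝ f x) (i : Fin N) :
    pd i (fun y => F (f y)) x = F' * pd i f x := by
  simp only [pd]
  have := (hF.comp_hasFDerivAt x hf.hasFDerivAt).fderiv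
  simp only [Function.comp_def] at this
  rw [this]
  simp

/-- Hardy-type inequality for positive superharmonic functions. -/
lemma integral_neg_lap_div_mul_sq_le {w φ : Euc N → ℝ} {Ω : Set (Euc N)} (hΩ : IsOpen Ω)
    (hw : ContDiffOn ℝ 2 w Ω) (hpos : ∀ x ∈ Ω, 0 < w x) (hφ : ContDiff ℝ 1 φ)
    (hc : HasCompactSupport φ) (hs : tsupport φ ⊆ Ω) :
    Integrable (fun x => -lap w x / w x * φ x ^ 2) ∧
    ∫ x, -lap w x / w x * φ x ^ 2 ≤ ∫ x, gradSq φ x := by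
  set θ : Euc N → ℝ := fun x => (w x)⁻¹ * φ x ^ 2 with hθ
  have hout : ∀ x, x ∉ tsupport φ → θ x = 0 := fun x hx => by
    simp [hθ, image_eq_zero_of_notMem_tsupport hx]
  have hsub : tsupport θ ⊆ tsupport φ := by
    refine closure_minimal (fun x hx => ?_) (isClosed_tsupport _)
    by_contra h'
    exact hx (hout x h')
  have hθc : ContDiff ℝ 1 θ := by
    have h1 : ContDiffOn ℝ 1 θ Ω :=
      ((hw.of_le (by norm_num)).inv fun x hx => (hpos x hx).ne').mul (hφ.contDiffOn.pow 2)
    refine contDiff_iff_contDiffAt.2 fun x => ?_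
    by_cases hx : x ∈ tsupport θ
    · exact h1.contDiffAt (hΩ.mem_nhds (hs (hsub hx)))
    · have : θ =ᶠ[nhds x] fun _ => 0 := notMem_tsupport_iff_eventuallyEq.1 hx
      exact contDiffAt_const.congr_of_eventuallyEq this
  obtain ⟨a1, a2, a3⟩ := integral_neg_lap_mul hΩ hw hθc (hc.mono' (subset_tsupport θ |>.trans hsub))
    (hsub.trans hs)
  have e : (fun x => -lap w x / w x * φ x ^ 2) = fun x => -lap w x * θ x := by
    ext x; simp only [hθ]; ring
  rw [e]
  refine ⟨a1, a3.trans_le (integral_mono a2 (integrable_gradSq hφ hc) fun x => ?_)⟩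
  by_cases hx : x ∈ tsupport φ
  · refine Finset.sum_le_sum fun i _ => ?_
    have hxΩ := hs hx
    have hwx := (hw.contDiffAt (hΩ.mem_nhds hxΩ)).differentiableAt two_ne_zero
    have hφx := hφ.differentiable one_ne_zero x
    have h0 := (hpos x hxΩ).ne'
    have hd : pd i θ x = -(w x ^ 2)⁻¹ * pd i w x * φ x ^ 2
        + (w x)⁻¹ * (2 * φ x * pd i φ x) := by
      rw [hθ, pd_mul (hwx.fun_inv h0) (hφx.fun_pow 2), pd_comp (hasDerivAt_inv h0) hwx,
        pd_comp (F := fun y => y ^ 2) (F' := 2 * φ x) (by simpa using hasDerivAt_pow 2 (φ x)) hφx]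
    rw [hd]
    have : pd i φ x ^ 2 - pd i w x * (-(w x ^ 2)⁻¹ * pd i w x * φ x ^ 2
        + (w x)⁻¹ * (2 * φ x * pd i φ x)) = (pd i φ x - φ x * pd i w x * (w x)⁻¹) ^ 2 := by
      field_simp; ring
    nlinarith [sq_nonneg (pd i φ x - φ x * pd i w x * (w x)⁻¹)]
  · simp [gradSq_eq_zero hx, pd_eq_zero (fun h => hx (hsub h))]

/-- Energy inequality obtained by testing `-Δw` against `w ^ (2t-1) η²`. -/
lemma integral_gradSq_rpow_mul_le {w η : Euc N → ℝ} (hw : ContDiff ℝ 2 w) (hpos : ∀ x, 0 < w x)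
    (hη : ContDiff ℝ 1 η) (hc : HasCompactSupport η) {t K : ℝ} (ht : 1 / 2 < t)
    (hK : t ^ 2 / (2 * t - 1) < K) :
    ∫ x, gradSq (fun y => w y ^ t * η y) x ≤
      K * (∫ x, -lap w x * (w x ^ (2 * t - 1) * η x ^ 2)) +
      (1 + (K - t) ^ 2 / (K * (2 * t - 1) - t ^ 2)) * ∫ x, w x ^ (2 * t) * gradSq η x := by
  have hw1 : ContDiff ℝ 1 w := hw.of_le (by norm_num)
  have hrp : ∀ s : ℝ, ContDiff ℝ 1 fun x => w x ^ s := fun s =>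
    hw1.rpow_const_of_ne fun x => (hpos x).ne'
  set θ : Euc N → ℝ := fun x => w x ^ (2 * t - 1) * η x ^ 2 with hθ
  have hsub : tsupport θ ⊆ tsupport η := by
    refine closure_minimal (fun x hx => ?_) (isClosed_tsupport _)
    by_contra h'
    exact hx (by simp [hθ, image_eq_zero_of_notMem_tsupport h'])
  obtain ⟨a1, a2, a3⟩ := integral_neg_lap_mul isOpen_univ hw.contDiffOn
    ((hrp (2 * t - 1)).mul (hη.pow 2)) (hc.mono' (subset_tsupport θ |>.trans hsub)) (subset_univ _)
  have hfs : HasCompactSupport fun y => w y ^ t * η y := hc.mul_left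
  have i1 := integrable_gradSq ((hrp t).mul hη) hfs
  have i2 : Integrable fun x => w x ^ (2 * t) * gradSq η x :=
    integrable_of_eq_zero_off ((hrp _).continuous.mul (continuous_gradSq hη)) hc
      fun x hx => by simp [gradSq_eq_zero hx]
  set D := K * (2 * t - 1) - t ^ 2 with hD
  have hD0 : 0 < D := by
    rw [div_lt_iff₀ (by linarith)] at hK
    linarith
  rw [a3, ← integral_const_mul, ← integral_const_mul, ← integral_add (a2.const_mul _)
    (i2.const_mul _)]
  refine integral_mono i1 ((a2.const_mul _).add (i2.const_mul _)) fun x => ?_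
  simp only [gradSq, Finset.mul_sum]
  rw [← Finset.sum_add_distrib]
  refine Finset.sum_le_sum fun i _ => ?_
  have h0 := hpos x
  have hwx := hw1.differentiable one_ne_zero x
  have hηx := hη.differentiable one_ne_zero x
  have d1 : ∀ s : ℝ, pd i (fun y => w y ^ s) x = s * w x ^ (s - 1) * pd i w x := fun s =>
    pd_comp (F := fun y => y ^ s) (Real.hasDerivAt_rpow_const (Or.inl h0.ne')) hwx i
  rw [pd_mul ((hrp t).differentiable one_ne_zero x) hηx,
    pd_mul ((hrp _).differentiable one_ne_zero x) (hηx.fun_pow 2), d1, d1,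
    pd_comp (F := fun y => y ^ 2) (F' := 2 * η x) (by simpa using hasDerivAt_pow 2 (η x)) hηx]
  have e1 : w x ^ t = w x ^ (t - 1) * w x := by
    rw [← Real.rpow_add_one h0.ne']; ring_nf
  have e2 : w x ^ (2 * t - 1) = w x ^ (t - 1) * w x ^ (t - 1) * w x := by
    rw [← Real.rpow_add h0, ← Real.rpow_add_one h0.ne']; ring_nf
  have e3 : w x ^ (2 * t - 1 - 1) = w x ^ (t - 1) * w x ^ (t - 1) := by
    rw [← Real.rpow_add h0]; ring_nf
  have e4 : w x ^ (2 * t) = w x ^ (t - 1) * w x ^ (t - 1) * w x ^ 2 := by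
    rw [← Real.rpow_add h0, ← Real.rpow_natCast, ← Real.rpow_add h0]; ring_nf
  rw [e1, e2, e3, e4]
  generalize w x ^ (t - 1) = z
  generalize pd i w x = a
  generalize pd i η x = b
  generalize w x = y
  generalize η x = n
  have key : K * (a * ((2 * t - 1) * (z * z) * a * n ^ 2 + z * z * y * (2 * n * b)))
      + (1 + (K - t) ^ 2 / D) * (z * z * y ^ 2 * b ^ 2) - (t * z * a * n + z * y * b) ^ 2
      = (D * (z * a * n) + (K - t) * (z * y * b)) ^ 2 / D := by
    field_simp
    rw [hD]
    ring
  have : 0 ≤ (D * (z * a * n) + (K - t) * (z * y * b)) ^ 2 / D := by positivity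
  linarith

/-- Quadratic form inequality for stable solutions. -/
lemma sqrt_mul_integral_le_of_stable {p q : ℝ} {u v φ : Euc N → ℝ} {Ω : Set (Euc N)}
    (hp : 0 < p) (hq : 0 < q) (hu : Continuous u) (hv : Continuous v)
    (hu0 : ∀ x, 0 < u x) (hv0 : ∀ x, 0 < v x) (hΩ : IsOpen Ω) (hst : LEStableOn p q u v Ω)
    (hφ : ContDiff ℝ 1 φ) (hc : HasCompactSupport φ) (hs : tsupport φ ⊆ Ω) :
    √(p * q) * ∫ x, u x ^ ((q - 1) / 2) * v x ^ ((p - 1) / 2) * φ x ^ 2 ≤ ∫ x, gradSq φ x := by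
  obtain ⟨ξ, ζ, hξ, hζ, hξ0, hζ0, h1, h2⟩ := hst
  obtain ⟨a1, a2⟩ := integral_neg_lap_div_mul_sq_le hΩ hξ hξ0 hφ hc hs
  obtain ⟨b1, b2⟩ := integral_neg_lap_div_mul_sq_le hΩ hζ hζ0 hφ hc hs
  have hcont : Continuous fun x => u x ^ ((q - 1) / 2) * v x ^ ((p - 1) / 2) * φ x ^ 2 :=
    ((hu.rpow_const fun x => Or.inl (hu0 x).ne').mul
      (hv.rpow_const fun x => Or.inl (hv0 x).ne')).mul (hφ.continuous.pow 2)
  have i1 : Integrable fun x => u x ^ ((q - 1) / 2) * v x ^ ((p - 1) / 2) * φ x ^ 2 :=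
    integrable_of_eq_zero_off hcont hc
      fun x hx => by simp [image_eq_zero_of_notMem_tsupport hx]
  have key : ∫ x, 2 * √(p * q) * (u x ^ ((q - 1) / 2) * v x ^ ((p - 1) / 2) * φ x ^ 2) ≤
      ∫ x, (-lap ξ x / ξ x * φ x ^ 2 + -lap ζ x / ζ x * φ x ^ 2) := by
    refine integral_mono (i1.const_mul _) (a1.add b1) fun x => ?_
    by_cases hx : x ∈ tsupport φ
    · have hxΩ := hs hx
      have e1 := hξ0 x hxΩ
      have e2 := hζ0 x hxΩ
      have c1 : p * v x ^ (p - 1) * ζ x / ξ x ≤ -lap ξ x / ξ x :=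
        div_le_div_of_nonneg_right (h1 x hxΩ) e1.le
      have c2 : q * u x ^ (q - 1) * ξ x / ζ x ≤ -lap ζ x / ζ x :=
        div_le_div_of_nonneg_right (h2 x hxΩ) e2.le
      set a := p * v x ^ (p - 1) * ζ x / ξ x with ha
      set b := q * u x ^ (q - 1) * ξ x / ζ x with hb
      set m := √(p * q) * (u x ^ ((q - 1) / 2) * v x ^ ((p - 1) / 2)) with hm
      have hvx := hv0 x
      have hux := hu0 x
      have hab : m ^ 2 = a * b := by
        have f1 : (u x ^ ((q - 1) / 2)) ^ 2 = u x ^ (q - 1) := by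
          rw [← Real.rpow_natCast, ← Real.rpow_mul hux.le]; norm_num
        have f2 : (v x ^ ((p - 1) / 2)) ^ 2 = v x ^ (p - 1) := by
          rw [← Real.rpow_natCast, ← Real.rpow_mul hvx.le]; norm_num
        rw [hm, mul_pow, mul_pow, Real.sq_sqrt (by positivity), f1, f2, ha, hb]
        field_simp
      have ha0 : 0 ≤ a := by positivity
      have hb0 : 0 ≤ b := by positivity
      have h2m : 2 * m ≤ a + b := by
        refine le_of_sq_le_sq ?_ (by positivity)
        nlinarith [sq_nonneg (a - b)]
      have := mul_le_mul_of_nonneg_right (h2m.trans (add_le_add c1 c2)) (sq_nonneg (φ x))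
      calc _ = 2 * m * φ x ^ 2 := by rw [hm]; ring
        _ ≤ _ := this
        _ = _ := by ring
    · simp [image_eq_zero_of_notMem_tsupport hx]
  rw [integral_const_mul, integral_add a1 b1] at key
  linarith

/-- Gagliardo–Nirenberg–Sobolev inequality for real functions, in terms of integrals. -/
lemma exists_sobolev_const (hN : 3 ≤ N) : ∃ C : ℝ, 0 < C ∧ ∀ f : Euc N → ℝ, ContDiff ℝ 1 f →
    HasCompactSupport f →
    (∫ x, |f x| ^ (2 * N / (N - 2) : ℝ)) ^ (((N : ℝ) - 2) / N) ≤ C * ∫ x, gradSq f x := by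
  have hN' : (3 : ℝ) ≤ N := by exact_mod_cast hN
  set S : NNReal := Real.toNNReal (2 * N / (N - 2)) with hS
  have hS0 : (0 : ℝ) < 2 * N / (N - 2) := div_pos (by linarith) (by linarith)
  have hSr : (S : ℝ) = 2 * N / (N - 2) := Real.coe_toNNReal _ hS0.le
  have hSne : S ≠ 0 := fun h => by
    rw [h, NNReal.coe_zero] at hSr; linarith
  set C0 := SNormLESNormFDerivOfEqConst ℝ (volume : Measure (Euc N)) (2 : NNReal)
  refine ⟨(C0 : ℝ) ^ 2 + 1, by positivity, fun f hf hc => ?_⟩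
  have hsob := eLpNorm_le_eLpNorm_fderiv_of_eq (volume : Measure (Euc N)) hf hc (p := 2) (p' := S)
    (by norm_num) (by simp; omega) (by
      rw [hSr]; simp
      have : (N : ℝ) - 2 ≠ 0 := by linarith
      have : (N : ℝ) ≠ 0 := by linarith
      field_simp)
  have m1 : MemLp f S volume := hf.continuous.memLp_of_hasCompactSupport hc
  have m2 : MemLp (fderiv ℝ f) (2 : NNReal) volume :=
    (hf.continuous_fderiv one_ne_zero).memLp_of_hasCompactSupport (hc.fderiv (𝕜 := ℝ))
  rw [m1.eLpNorm_eq_integral_rpow_norm (by simpa using hSne) (by simp),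
    m2.eLpNorm_eq_integral_rpow_norm (by norm_num) (by simp), ENNReal.coe_toReal, hSr,
    ENNReal.coe_toReal, ← ENNReal.ofReal_coe_nnreal (p := C0), ← ENNReal.ofReal_mul (by positivity),
    ENNReal.ofReal_le_ofReal_iff (by positivity)] at hsob
  simp only [Real.norm_eq_abs, NNReal.coe_ofNat] at hsob
  set F := ∫ x, |f x| ^ (2 * N / (N - 2) : ℝ) with hF
  have hF0 : 0 ≤ F := integral_nonneg fun x => by positivity
  set D := ∫ x, ‖fderiv ℝ f x‖ ^ (2 : ℝ) with hD
  have hD0 : 0 ≤ D := integral_nonneg fun x => by positivity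
  have hDG : D ≤ ∫ x, gradSq f x := by
    refine integral_mono ?_ (integrable_gradSq hf hc) fun x => ?_
    · have := m2.integrable_norm_rpow (by norm_num) (by simp)
      simpa using this
    · simp only [Real.rpow_ofNat]
      have hb : ‖fderiv ℝ f x‖ ≤ √(gradSq f x) := by
        refine ContinuousLinearMap.opNorm_le_bound _ (Real.sqrt_nonneg _) fun y => ?_
        have hy : fderiv ℝ f x y = ∑ i, y i * pd i f x := by
          conv_lhs => rw [← (EuclideanSpace.basisFun (Fin N) ℝ).sum_repr y]
          simp [pd]
        rw [hy, Real.norm_eq_abs, EuclideanSpace.norm_eq, ← Real.sqrt_mul (gradSq_nonneg f x)]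
        refine Real.abs_le_sqrt ?_
        simp only [Real.norm_eq_abs, sq_abs]
        rw [mul_comm]
        exact Finset.sum_mul_sq_le_sq_mul_sq _ _ _
      calc _ ≤ √(gradSq f x) ^ 2 := by gcongr
        _ = _ := Real.sq_sqrt (gradSq_nonneg f x)
  have h2 := pow_le_pow_left₀ (by positivity) hsob 2
  have hl : (F ^ ((2 * N / (N - 2) : ℝ)⁻¹)) ^ 2 = F ^ (((N : ℝ) - 2) / N) := by
    rw [← Real.rpow_natCast, ← Real.rpow_mul hF0]
    congr 1
    have : (N : ℝ) - 2 ≠ 0 := by linarith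
    have : (N : ℝ) ≠ 0 := by linarith
    field_simp
    norm_num
  have hr : ((C0 : ℝ) * D ^ ((2 : ℝ)⁻¹)) ^ 2 = C0 ^ 2 * D := by
    rw [mul_pow, ← Real.rpow_natCast (D ^ _), ← Real.rpow_mul hD0]; norm_num
  rw [hl, hr] at h2
  calc _ ≤ _ := h2
    _ ≤ ((C0 : ℝ) ^ 2 + 1) * D := by nlinarith
    _ ≤ _ := by gcongr

/-- Cut-off functions at scale `R` with gradient of size `1 / R`. -/
lemma exists_cutoff (N : ℕ) : ∃ B : ℝ, 0 < B ∧ ∀ R : ℝ, 0 < R → ∃ χ : Euc N → ℝ, ContDiff ℝ 1 χ ∧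
    (∀ x, 0 ≤ χ x) ∧ (∀ x, χ x ≤ 1) ∧ (∀ x, ‖x‖ ≤ R → χ x = 1) ∧
    tsupport χ ⊆ closedBall 0 (2 * R) ∧ (∀ x, gradSq χ x ≤ B / R ^ 2) ∧
    (∀ x, ‖x‖ < R → ∀ i, pd i χ x = 0) := by
  let χ₀ : ContDiffBump (0 : Euc N) := ⟨1, 2, one_pos, one_lt_two⟩
  have hχ : ContDiff ℝ 1 χ₀ := χ₀.contDiff
  obtain ⟨B, hB⟩ := (continuous_gradSq hχ).bounded_above_of_compact_support
    (hasCompactSupport_def.2 <| χ₀.hasCompactSupport.of_isClosed_subset (isClosed_tsupport _)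
      (closure_minimal (fun x hx => by
        by_contra h'
        exact hx (gradSq_eq_zero h')) (isClosed_tsupport _)))
  refine ⟨|B| + 1, by positivity, fun R hR => ⟨fun x => χ₀ (R⁻¹ • x), ?_, ?_, ?_, ?_, ?_, ?_, ?_⟩⟩
  · exact hχ.comp (contDiff_const_smul _)
  · exact fun x => χ₀.nonneg
  · exact fun x => χ₀.le_one
  · intro x hx
    refine χ₀.one_of_mem_closedBall ?_
    rw [mem_closedBall_zero_iff, norm_smul, norm_inv, Real.norm_of_nonneg hR.le]
    exact (inv_mul_le_one₀ hR).2 hx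
  · refine closure_minimal (fun x hx => ?_) isClosed_closedBall
    have : R⁻¹ • x ∈ Function.support χ₀ := hx
    rw [χ₀.support_eq, mem_ball_zero_iff, norm_smul, norm_inv, Real.norm_of_nonneg hR.le,
      inv_mul_lt_iff₀ hR] at this
    rw [mem_closedBall_zero_iff]
    change _ < R * 2 at this
    linarith
  · intro x
    have : gradSq (fun x => χ₀ (R⁻¹ • x)) x = gradSq χ₀ (R⁻¹ • x) / R ^ 2 := by
      simp only [gradSq, pd, Finset.sum_div]
      refine Finset.sum_congr rfl fun i _ => ?_
      have := fderiv_comp_smul (𝕜 := ℝ) (f := χ₀) (c := R⁻¹) (x := x)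
      rw [this]
      simp
      field_simp
    rw [this]
    refine div_le_div_of_nonneg_right ?_ (by positivity)
    have := hB (R⁻¹ • x)
    rw [Real.norm_eq_abs] at this
    linarith [le_abs_self (gradSq χ₀ (R⁻¹ • x)), le_abs_self B]
  · intro x hx i
    have : (fun x => χ₀ (R⁻¹ • x)) =ᶠ[nhds x] fun _ => (1 : ℝ) := by
      filter_upwards [isOpen_ball.mem_nhds (mem_ball_zero_iff.2 hx)] with y hy
      refine χ₀.one_of_mem_closedBall ?_
      rw [mem_closedBall_zero_iff, norm_smul, norm_inv, Real.norm_of_nonneg hR.le]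
      exact (inv_mul_le_one₀ hR).2 (mem_ball_zero_iff.1 hy).le
    simp only [pd]
    rw [this.fderiv_eq]
    simp

lemma second_deriv_nonpos_of_isLocalMax {h h' : ℝ → ℝ} {h'' : ℝ}
    (h1 : ∀ᶠ s in nhds 0, HasDerivAt h (h' s) s) (h2 : HasDerivAt h' h'' 0)
    (hm : IsLocalMax h 0) : h'' ≤ 0 := by
  by_contra! hpos
  have e : deriv h =ᶠ[nhds 0] h' := h1.mono fun s hs => hs.deriv
  have hdd : deriv (deriv h) 0 = h'' := by rw [e.deriv_eq, h2.deriv]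
  have hmin := isLocalMin_of_deriv_deriv_pos (hdd ▸ hpos) hm.deriv_eq_zero
    h1.self_of_nhds.continuousAt
  have hconst : h =ᶠ[nhds 0] fun _ => h 0 := by
    filter_upwards [hm, hmin] with s a b using le_antisymm a b
  have : deriv (deriv h) 0 = 0 := by
    rw [hconst.deriv.deriv_eq]; simp
  linarith

/-- One-dimensional inequality at a local maximum of `(V - l U ^ σ) ρ ^ m`, with
`ρ s = ρ₀ - 2 y s - s ^ 2`. -/
lemma second_deriv_le_of_isLocalMax {U V U' V' : ℝ → ℝ} {U'' V'' l σ m y ρ₀ : ℝ}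
    (hU : ∀ s, HasDerivAt U (U' s) s) (hU2 : HasDerivAt U' U'' 0)
    (hV : ∀ s, HasDerivAt V (V' s) s) (hV2 : HasDerivAt V' V'' 0)
    (hU0 : ∀ s, 0 < U s) (hl : 0 ≤ l) (hσ : 0 < σ) (hσ1 : σ ≤ 1) (hρ : 0 < ρ₀)
    (hw : l * U 0 ^ σ < V 0)
    (hmax : ∀ᶠ s in nhds 0, (V s - l * U s ^ σ) * (ρ₀ - 2 * y * s - s ^ 2) ^ m ≤
      (V 0 - l * U 0 ^ σ) * ρ₀ ^ m) :
    V'' - l * σ * U 0 ^ (σ - 1) * U'' ≤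
      (V 0 - l * U 0 ^ σ) * ((4 * m * (m + 1) * y ^ 2 + 2 * m * ρ₀) / ρ₀ ^ 2) := by
  set w : ℝ → ℝ := fun s => V s - l * U s ^ σ with hwdef
  set w' : ℝ → ℝ := fun s => V' s - l * (U' s * σ * U s ^ (σ - 1)) with hw'
  set ρ : ℝ → ℝ := fun s => ρ₀ - 2 * y * s - s ^ 2 with hρdef
  have dw : ∀ s, HasDerivAt w (w' s) s := fun s =>
    (hV s).sub (((hU s).rpow_const (Or.inl (hU0 s).ne')).const_mul l)
  have dρ : ∀ s, HasDerivAt ρ (-2 * y - 2 * s) s := fun s => by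
    have := (((hasDerivAt_id s).const_mul (2 * y)).const_sub ρ₀).sub (hasDerivAt_pow 2 s)
    exact this.congr_deriv (by simp)
  set w'' := V'' - l * ((U'' * σ) * U 0 ^ (σ - 1) +
    U' 0 * σ * (U' 0 * (σ - 1) * U 0 ^ (σ - 1 - 1))) with hw''
  have dw' : HasDerivAt w' w'' 0 :=
    hV2.sub (((hU2.mul_const σ).mul ((hU 0).rpow_const (Or.inl (hU0 0).ne'))).const_mul l)
  have dρ' : HasDerivAt (fun s => -2 * y - 2 * s) (-2) 0 := by
    simpa using ((hasDerivAt_id (0 : ℝ)).const_mul 2).const_sub (-2 * y)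
  have w0 : 0 < w 0 := by simp only [hwdef]; linarith
  have ρ0 : ρ 0 = ρ₀ := by simp [hρdef]
  have ew : ∀ᶠ s in nhds 0, 0 < w s := (dw 0).continuousAt.eventually (lt_mem_nhds w0)
  have eρ : ∀ᶠ s in nhds 0, 0 < ρ s :=
    (dρ 0).continuousAt.eventually (lt_mem_nhds (by rw [ρ0]; exact hρ))
  have hL : ∀ᶠ s in nhds 0, HasDerivAt (fun s => Real.log (w s) + m * Real.log (ρ s))
      (w' s / w s + m * ((-2 * y - 2 * s) / ρ s)) s := by
    filter_upwards [ew, eρ] with s h1 h2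
    exact ((dw s).log h1.ne').add (((dρ s).log h2.ne').const_mul m)
  have hL2 : HasDerivAt (fun s => w' s / w s + m * ((-2 * y - 2 * s) / ρ s))
      ((w'' * w 0 - w' 0 * w' 0) / w 0 ^ 2 +
        m * (((-2) * ρ 0 - (-2 * y - 2 * 0) * (-2 * y - 2 * 0)) / ρ 0 ^ 2)) 0 :=
    (dw'.div (dw 0) w0.ne').add ((dρ'.div (dρ 0) (by rw [ρ0]; exact hρ.ne')).const_mul m)
  have hLmax : IsLocalMax (fun s => Real.log (w s) + m * Real.log (ρ s)) 0 := by
    filter_upwards [ew, eρ, hmax] with s h1 h2 h3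
    have e : ∀ s, 0 < w s → 0 < ρ s →
        Real.log (w s) + m * Real.log (ρ s) = Real.log (w s * ρ s ^ m) := fun s h1 h2 => by
      rw [Real.log_mul h1.ne' (by positivity), Real.log_rpow h2]
    rw [e s h1 h2, e 0 w0 (by rw [ρ0]; exact hρ)]
    refine Real.log_le_log (by positivity) ?_
    rw [ρ0]
    exact h3
  have k1 := second_deriv_nonpos_of_isLocalMax hL hL2 hLmax
  have k2 := hLmax.hasDerivAt_eq_zero hL.self_of_nhds
  rw [ρ0] at k1 k2
  have hww' : w' 0 = 2 * m * y / ρ₀ * w 0 := by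
    field_simp at k2 ⊢
    linarith
  rw [hww'] at k1
  have k3 : w'' ≤ w 0 * ((4 * m * (m + 1) * y ^ 2 + 2 * m * ρ₀) / ρ₀ ^ 2) := by
    have : w'' - w 0 * ((4 * m * (m + 1) * y ^ 2 + 2 * m * ρ₀) / ρ₀ ^ 2) =
        w 0 * ((w'' * w 0 - 2 * m * y / ρ₀ * w 0 * (2 * m * y / ρ₀ * w 0)) / w 0 ^ 2 +
        m * (((-2) * ρ₀ - (-2 * y - 2 * 0) * (-2 * y - 2 * 0)) / ρ₀ ^ 2)) := by
      field_simp
      ring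
    nlinarith [mul_nonneg w0.le (sub_nonneg.2 k1)]
  refine le_trans ?_ k3
  have : 0 ≤ l * (U' 0 ^ 2 * σ * (1 - σ) * U 0 ^ (σ - 1 - 1)) := by
    have := hU0 0
    have : 0 ≤ 1 - σ := by linarith
    positivity
  rw [hw'']
  nlinarith

lemma hasDerivAt_line {f : Euc N → ℝ} (hf : Differentiable ℝ f) (x : Euc N) (i : Fin N) (s : ℝ) :
    HasDerivAt (fun s : ℝ => f (x + s • EuclideanSpace.single i (1 : ℝ)))
      (pd i f (x + s • EuclideanSpace.single i (1 : ℝ))) s := by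
  have h1 : HasDerivAt (fun s : ℝ => x + s • EuclideanSpace.single i (1 : ℝ))
      (EuclideanSpace.single i (1 : ℝ)) s := by
    simpa using ((hasDerivAt_id s).smul_const (EuclideanSpace.single i (1 : ℝ))).const_add x
  exact (hf _).hasFDerivAt.comp_hasDerivAt s h1

/-- Differential inequality at an interior maximum of `(v - l u ^ σ) (R² - |x - x₀|²) ^ m`. -/
lemma lap_le_of_max {u v : Euc N → ℝ} {l σ m R : ℝ} {x₀ x : Euc N}
    (hu : ContDiff ℝ 2 u) (hv : ContDiff ℝ 2 v) (hu0 : ∀ x, 0 < u x) (hl : 0 ≤ l) (hσ : 0 < σ)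
    (hσ1 : σ ≤ 1) (hm : 0 < m) (hx : ‖x - x₀‖ < R) (hw : l * u x ^ σ < v x)
    (hmax : ∀ y, ‖y - x₀‖ < R → (v y - l * u y ^ σ) * (R ^ 2 - ‖y - x₀‖ ^ 2) ^ m ≤
      (v x - l * u x ^ σ) * (R ^ 2 - ‖x - x₀‖ ^ 2) ^ m) :
    lap v x - l * σ * u x ^ (σ - 1) * lap u x ≤
      (v x - l * u x ^ σ) *
        ((4 * m * (m + 1) + 2 * m * N) * R ^ 2 / (R ^ 2 - ‖x - x₀‖ ^ 2) ^ 2) := by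
  set ρ₀ := R ^ 2 - ‖x - x₀‖ ^ 2 with hρ₀
  have hρ : 0 < ρ₀ := by
    have := norm_nonneg (x - x₀)
    nlinarith
  have hd : ∀ {f : Euc N → ℝ}, ContDiff ℝ 2 f → ∀ i, Differentiable ℝ (pd i f) := fun hf i =>
    (contDiffOn_univ.1 (contDiffOn_pd isOpen_univ (n := 2) (m := 1) hf.contDiffOn
      (by norm_num) i)).differentiable one_ne_zero
  have key : ∀ i : Fin N, pd i (pd i v) x - l * σ * u x ^ (σ - 1) * pd i (pd i u) x ≤
      (v x - l * u x ^ σ) * ((4 * m * (m + 1) * (x i - x₀ i) ^ 2 + 2 * m * ρ₀) / ρ₀ ^ 2) := by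
    intro i
    have hnorm : ∀ s : ℝ, R ^ 2 - ‖x + s • EuclideanSpace.single i (1 : ℝ) - x₀‖ ^ 2 =
        ρ₀ - 2 * (x i - x₀ i) * s - s ^ 2 := by
      intro s
      have : x + s • EuclideanSpace.single i (1 : ℝ) - x₀ =
        (x - x₀) + s • EuclideanSpace.single i (1 : ℝ) := by abel
      rw [this, norm_add_sq_real, hρ₀, inner_smul_right, norm_smul, mul_pow,
        EuclideanSpace.inner_single_right]
      simp
      ring
    have hc : Filter.Tendsto (fun s : ℝ => x + s • EuclideanSpace.single i (1 : ℝ)) (nhds 0)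
        (nhds x) := by
      have : Continuous fun s : ℝ => x + s • EuclideanSpace.single i (1 : ℝ) := by fun_prop
      simpa using this.tendsto 0
    have hnear : ∀ᶠ y in nhds x, ‖y - x₀‖ < R :=
      (by fun_prop : Continuous fun y : Euc N => ‖y - x₀‖).continuousAt.eventually (gt_mem_nhds hx)
    have := second_deriv_le_of_isLocalMax (l := l) (σ := σ) (m := m) (y := x i - x₀ i) (ρ₀ := ρ₀)
      (hasDerivAt_line (hu.differentiable two_ne_zero) x i)
      (hasDerivAt_line (hd hu i) x i 0)
      (hasDerivAt_line (hv.differentiable two_ne_zero) x i)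
      (hasDerivAt_line (hd hv i) x i 0) (fun s => hu0 _) hl hσ hσ1 hρ (by simpa using hw)
      (by
        filter_upwards [hc.eventually hnear] with s hs
        have := hmax _ hs
        rw [hnorm] at this
        simpa using this)
    simpa using this
  rw [lap_eq_sum_pd_pd hu.contDiffAt, lap_eq_sum_pd_pd hv.contDiffAt, Finset.mul_sum,
    ← Finset.sum_sub_distrib]
  refine (Finset.sum_le_sum fun i _ => key i).trans ?_
  rw [← Finset.mul_sum, ← Finset.sum_div, Finset.sum_add_distrib, ← Finset.mul_sum]
  have hn : ∑ i, (x i - x₀ i) ^ 2 = ‖x - x₀‖ ^ 2 := by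
    rw [EuclideanSpace.norm_sq_eq]; simp
  rw [hn]
  refine mul_le_mul_of_nonneg_left (div_le_div_of_nonneg_right ?_ (by positivity))
    (by linarith)
  simp only [Finset.sum_const, Finset.card_univ, Fintype.card_fin, nsmul_eq_mul]
  have h1 : ‖x - x₀‖ ^ 2 ≤ R ^ 2 := by linarith
  have h2 : ρ₀ ≤ R ^ 2 := by rw [hρ₀]; nlinarith [sq_nonneg ‖x - x₀‖]
  have h3 : 4 * m * (m + 1) * ‖x - x₀‖ ^ 2 ≤ 4 * m * (m + 1) * R ^ 2 := by gcongr
  have h4 : 2 * m * N * ρ₀ ≤ 2 * m * N * R ^ 2 := by gcongr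
  linarith

/-- Pointwise inequality behind the comparison principle. -/
lemma rpow_comparison {p q σ l a b : ℝ} (hp : 1 ≤ p) (hσ : 0 < σ) (hσ1 : σ ≤ 1)
    (hσpq : σ * (p + 1) = q + 1) (hl : 0 < l) (hlσ : l * σ = l ^ (-p)) (ha : 0 < a)
    (hab : l * a ^ σ < b) :
    l ^ (-p) * l ^ ((1 - σ) / σ) * (b ^ (p - 1 / σ) * (b - l * a ^ σ)) ≤
      l * σ * a ^ (σ - 1) * b ^ p - a ^ q := by
  set d := l * a ^ σ with hd
  have hd0 : 0 < d := by positivity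
  have hb : 0 < b := hd0.trans hab
  have e1 : a ^ q = l ^ (-p) * a ^ (σ - 1) * d ^ p := by
    rw [hd, Real.mul_rpow hl.le (by positivity), ← Real.rpow_mul ha.le, Real.rpow_neg hl.le]
    have : a ^ q = a ^ (σ - 1) * a ^ (σ * p) := by
      rw [← Real.rpow_add ha]; congr 1; linarith
    rw [this]
    field_simp
  have e2 : l ^ ((1 - σ) / σ) * b ^ ((σ - 1) / σ) ≤ a ^ (σ - 1) := by
    have h1 : b ^ ((σ - 1) / σ) ≤ d ^ ((σ - 1) / σ) :=
      Real.rpow_le_rpow_of_nonpos hd0 hab.le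
        (div_nonpos_of_nonpos_of_nonneg (by linarith) hσ.le)
    have h2 : l ^ ((1 - σ) / σ) * d ^ ((σ - 1) / σ) = a ^ (σ - 1) := by
      rw [hd, Real.mul_rpow hl.le (by positivity), ← Real.rpow_mul ha.le, ← mul_assoc,
        ← Real.rpow_add hl]
      have : (1 - σ) / σ + (σ - 1) / σ = 0 := by ring
      rw [this, Real.rpow_zero, one_mul]
      congr 1
      field_simp
    rw [← h2]
    gcongr
  have e3 : b ^ (p - 1) * (b - d) ≤ b ^ p - d ^ p := by
    have h1 : b ^ p = b ^ (p - 1) * b := by rw [← Real.rpow_add_one hb.ne']; ring_nf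
    have h2 : d ^ p = d ^ (p - 1) * d := by rw [← Real.rpow_add_one hd0.ne']; ring_nf
    have h3 : d ^ (p - 1) ≤ b ^ (p - 1) := Real.rpow_le_rpow hd0.le hab.le (by linarith)
    rw [h1, h2]
    nlinarith [mul_le_mul_of_nonneg_right h3 hd0.le]
  have e4 : b ^ (p - 1 / σ) = b ^ ((σ - 1) / σ) * b ^ (p - 1) := by
    rw [← Real.rpow_add hb]; congr 1; field_simp; ring
  rw [e1, e4, hlσ]
  calc _ = l ^ (-p) * ((l ^ ((1 - σ) / σ) * b ^ ((σ - 1) / σ)) * (b ^ (p - 1) * (b - d))) := by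
        ring
    _ ≤ l ^ (-p) * (a ^ (σ - 1) * (b ^ p - d ^ p)) := by
        have : 0 ≤ b ^ (p - 1) * (b - d) := mul_nonneg (by positivity) (by linarith)
        gcongr
    _ = _ := by ring

/-- Comparison principle: `v ≤ l u ^ σ`, with `σ = (q+1)/(p+1)`, for positive entire solutions. -/
lemma exists_comparison {p q : ℝ} {u v : Euc N → ℝ} (hq : 0 < q) (hqp : q ≤ p) (hpq : 1 < p * q)
    (hu : ContDiff ℝ 2 u) (hv : ContDiff ℝ 2 v) (hu0 : ∀ x, 0 < u x)
    (h1 : ∀ x, -lap u x = v x ^ p) (h2 : ∀ x, -lap v x = u x ^ q) :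
    ∃ l : ℝ, 0 < l ∧ ∀ x, v x ≤ l * u x ^ ((q + 1) / (p + 1)) := by
  have hp : 1 < p := by nlinarith
  set σ := (q + 1) / (p + 1) with hσdef
  have hσ : 0 < σ := by positivity
  have hσ1 : σ ≤ 1 := (div_le_one (by linarith)).2 (by linarith)
  have hσpq : σ * (p + 1) = q + 1 := by rw [hσdef]; field_simp
  set l := σ ^ (-(1 / (p + 1))) with hl
  have hl0 : 0 < l := by positivity
  have hlσ : l * σ = l ^ (-p) := by
    rw [hl, ← Real.rpow_mul hσ.le, ← Real.rpow_add_one hσ.ne']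
    congr 1
    field_simp
    ring
  refine ⟨l, hl0, ?_⟩
  by_contra! hcon
  obtain ⟨x₀, hx₀⟩ := hcon
  set γ := p - 1 / σ with hγ
  have hγ0 : 0 < γ := by
    have : γ = (p * q - 1) / (q + 1) := by rw [hγ, hσdef]; field_simp; ring
    rw [this]
    exact div_pos (by linarith) (by linarith)
  set m := 2 / γ with hm
  have hm0 : 0 < m := by positivity
  set c := l ^ (-p) * l ^ ((1 - σ) / σ) with hc
  have hc0 : 0 < c := by positivity
  set C := 4 * m * (m + 1) + 2 * m * N with hC
  have hC0 : 0 ≤ C := by positivity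
  set w : Euc N → ℝ := fun x => v x - l * u x ^ σ with hw
  have hwc : Continuous w := hv.continuous.sub
    ((hu.continuous.rpow_const fun x => Or.inl (hu0 x).ne').const_mul l |> fun h => h)
  have hw0 : 0 < w x₀ := by simp only [hw]; linarith
  have main : ∀ R : ℝ, 0 < R → c * w x₀ ^ γ * R ^ 2 ≤ C := by
    intro R hR
    set H : Euc N → ℝ := fun y => w y * (R ^ 2 - ‖y - x₀‖ ^ 2) ^ m with hH
    have hHc : Continuous H := by
      refine hwc.mul (Continuous.rpow_const (by fun_prop) fun _ => Or.inr hm0.le)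
    obtain ⟨x, hxmem, hxmax⟩ := (isCompact_closedBall x₀ R).exists_isMaxOn
      ⟨x₀, mem_closedBall_self hR.le⟩ hHc.continuousOn
    have hH0 : H x₀ = w x₀ * (R ^ 2) ^ m := by simp [hH]
    have hHx : H x₀ ≤ H x := hxmax (mem_closedBall_self hR.le)
    have hHpos : 0 < H x := lt_of_lt_of_le (by rw [hH0]; positivity) hHx
    have hxR : ‖x - x₀‖ < R := by
      refine lt_of_le_of_ne (by simpa [dist_eq_norm] using hxmem) fun h => ?_
      simp only [hH, h, sub_self, Real.zero_rpow hm0.ne', mul_zero] at hHpos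
      exact lt_irrefl _ hHpos
    set ρ₀ := R ^ 2 - ‖x - x₀‖ ^ 2 with hρ₀
    have hρ : 0 < ρ₀ := by
      have := norm_nonneg (x - x₀)
      nlinarith
    have hρR : ρ₀ ≤ R ^ 2 := by rw [hρ₀]; nlinarith [sq_nonneg ‖x - x₀‖]
    have hwx : 0 < w x := by
      have : 0 < w x * ρ₀ ^ m := hHpos
      exact pos_of_mul_pos_left this (by positivity)
    have hwx' : l * u x ^ σ < v x := by
      simp only [hw] at hwx; linarith
    have k1 := lap_le_of_max hu hv hu0 hl0.le hσ hσ1 hm0 hxR hwx' fun y hy =>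
      hxmax (show y ∈ closedBall x₀ R by simpa [dist_eq_norm] using hy.le)
    have k2 := rpow_comparison hp.le hσ hσ1 hσpq hl0 hlσ (hu0 x) hwx'
    have k3 : c * (v x ^ γ * w x) ≤ w x * (C * R ^ 2 / ρ₀ ^ 2) := by
      refine k2.trans (le_trans (le_of_eq ?_) k1)
      linear_combination -(l * σ * u x ^ (σ - 1)) * h1 x + h2 x
    have k4 : c * w x ^ γ ≤ C * R ^ 2 / ρ₀ ^ 2 := by
      have hle : w x ^ γ ≤ v x ^ γ := by
        refine Real.rpow_le_rpow hwx.le ?_ hγ0.le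
        simp only [hw]
        have := Real.rpow_pos_of_pos (hu0 x) σ
        nlinarith [mul_pos hl0 this]
      have : c * v x ^ γ * w x ≤ C * R ^ 2 / ρ₀ ^ 2 * w x := by linarith
      exact (mul_le_mul_of_nonneg_left hle hc0.le).trans (le_of_mul_le_mul_right this hwx)
    have hmγ : m * γ = 2 := by rw [hm]; field_simp
    have k5 : w x₀ ^ γ * (R ^ 2) ^ 2 ≤ w x ^ γ * ρ₀ ^ 2 := by
      have := Real.rpow_le_rpow (by rw [hH0]; positivity) hHx hγ0.le
      rw [hH0] at this
      change _ ≤ (w x * ρ₀ ^ m) ^ γ at this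
      rw [Real.mul_rpow hw0.le (by positivity), Real.mul_rpow hwx.le (by positivity),
        ← Real.rpow_mul (by positivity), ← Real.rpow_mul hρ.le, hmγ] at this
      simpa using this
    have k6 : c * w x ^ γ * ρ₀ ^ 2 ≤ C * R ^ 2 := by
      rwa [le_div_iff₀ (by positivity)] at k4
    have hR2 : 0 < R ^ 2 := by positivity
    refine le_of_mul_le_mul_right ?_ hR2
    calc c * w x₀ ^ γ * R ^ 2 * R ^ 2 = c * (w x₀ ^ γ * (R ^ 2) ^ 2) := by ring
      _ ≤ c * (w x ^ γ * ρ₀ ^ 2) := mul_le_mul_of_nonneg_left k5 hc0.le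
      _ = c * w x ^ γ * ρ₀ ^ 2 := by ring
      _ ≤ C * R ^ 2 := k6
  have hcb : 0 < c * w x₀ ^ γ := mul_pos hc0 (Real.rpow_pos_of_pos hw0 γ)
  clear_value c C γ w
  obtain ⟨R, hR⟩ := exists_gt ((C + 1) / (c * w x₀ ^ γ))
  have hR1 := (div_lt_iff₀ hcb).1 hR
  have hR0 : 0 < R := lt_of_le_of_lt (by positivity) hR
  have h3 := main (R + 1) (by linarith)
  generalize c * w x₀ ^ γ = d at *
  nlinarith [mul_pos hcb hR0, mul_pos (mul_pos hcb hR0) hR0]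

lemma hasCompactSupport_of_subset_closedBall {χ : Euc N → ℝ} {r : ℝ}
    (hs : tsupport χ ⊆ closedBall 0 r) : HasCompactSupport χ :=
  (isCompact_closedBall 0 r).of_isClosed_subset (isClosed_tsupport _) hs

lemma integral_gradSq_le_of_le {χ : Euc N → ℝ} {r b : ℝ} (hχ : ContDiff ℝ 1 χ) (hr : 0 ≤ r)
    (hs : tsupport χ ⊆ closedBall 0 r) (hb : ∀ x, gradSq χ x ≤ b) :
    ∫ x, gradSq χ x ≤ b * (r ^ N * volume.real (closedBall (0 : Euc N) 1)) := by
  have hfin := finrank_euclideanSpace_fin (𝕜 := ℝ) (n := N)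
  have hvol := Measure.addHaar_real_closedBall' (volume : Measure (Euc N)) 0 hr
  rw [hfin] at hvol
  rw [← setIntegral_eq_integral_of_forall_compl_eq_zero (s := closedBall (0 : Euc N) r)
    fun x hx => gradSq_eq_zero fun h => hx (hs h)]
  calc ∫ x in closedBall (0 : Euc N) r, gradSq χ x ≤ ∫ x in closedBall (0 : Euc N) r, b := by
        refine integral_mono
          (integrable_gradSq hχ (hasCompactSupport_of_subset_closedBall hs)).integrableOn ?_ hb
        exact integrableOn_const (measure_closedBall_lt_top.ne)
    _ = _ := by rw [setIntegral_const, hvol, smul_eq_mul, mul_comm]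

/-- Caccioppoli-type bound coming from `-Δv = u ^ q` and the comparison `v ≤ l u ^ σ`. -/
lemma integral_rpow_mul_sq_le {q σ l : ℝ} {u v φ : Euc N → ℝ} (hv : ContDiff ℝ 2 v)
    (hu0 : ∀ x, 0 < u x) (hv0 : ∀ x, 0 < v x) (h2 : ∀ x, -lap v x = u x ^ q)
    (hl : 0 < l) (hcomp : ∀ x, v x ≤ l * u x ^ σ) (hφ : ContDiff ℝ 1 φ)
    (hc : HasCompactSupport φ) :
    ∫ x, u x ^ (q - σ) * φ x ^ 2 ≤ l * ∫ x, gradSq φ x := by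
  obtain ⟨hi, hle⟩ := integral_neg_lap_div_mul_sq_le isOpen_univ hv.contDiffOn
    (fun x _ => hv0 x) hφ hc (subset_univ _)
  refine le_trans ?_ (mul_le_mul_of_nonneg_left hle hl.le)
  rw [← integral_const_mul]
  refine integral_mono_of_nonneg (.of_forall fun x => ?_) (hi.const_mul l) (.of_forall fun x => ?_)
  · have := hu0 x
    positivity
  · have hux := hu0 x
    have hvx := hv0 x
    have h3 : u x ^ (q - σ) ≤ l * (u x ^ q / v x) := by
      rw [Real.rpow_sub hux, ← mul_div_assoc, div_le_div_iff₀ (by positivity) hvx]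
      have := mul_le_mul_of_nonneg_left (hcomp x) (Real.rpow_pos_of_pos hux q).le
      linarith
    simp only [h2]
    have := mul_le_mul_of_nonneg_right h3 (sq_nonneg (φ x))
    linarith

lemma setIntegral_le_integral_mul_sq {f φ : Euc N → ℝ} {R : ℝ} (hf : Continuous f)
    (hf0 : ∀ x, 0 ≤ f x) (hφ : Continuous φ) (hc : HasCompactSupport φ)
    (h1 : ∀ x, ‖x‖ ≤ R → φ x = 1) :
    ∫ x in closedBall 0 R, f x ≤ ∫ x, f x * φ x ^ 2 := by
  have hi : Integrable fun x => f x * φ x ^ 2 :=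
    integrable_of_eq_zero_off (by fun_prop) hc fun x hx => by
      simp [image_eq_zero_of_notMem_tsupport hx]
  calc ∫ x in closedBall 0 R, f x = ∫ x in closedBall 0 R, f x * φ x ^ 2 := by
        refine setIntegral_congr_fun measurableSet_closedBall fun x hx => ?_
        simp [h1 x (by simpa using hx)]
    _ ≤ _ := setIntegral_le_integral hi (.of_forall fun x => mul_nonneg (hf0 x) (sq_nonneg _))

/-- Growth of the integral over balls of a weight satisfying a Hardy-type inequality. -/
lemma exists_setIntegral_le {f : Euc N → ℝ} {l : ℝ} (hf : Continuous f) (hf0 : ∀ x, 0 ≤ f x)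
    (hl : 0 < l) (h : ∀ φ : Euc N → ℝ, ContDiff ℝ 1 φ → HasCompactSupport φ →
      ∫ x, f x * φ x ^ 2 ≤ l * ∫ x, gradSq φ x) :
    ∃ C : ℝ, 0 ≤ C ∧ ∀ R : ℝ, 0 < R →
      ∫ x in closedBall 0 R, f x ≤ C * R ^ ((N : ℝ) - 2) := by
  obtain ⟨B, hB, hcut⟩ := exists_cutoff N
  refine ⟨l * (B * (2 ^ N * volume.real (closedBall (0 : Euc N) 1))), by positivity,
    fun R hR => ?_⟩
  obtain ⟨χ, hχ, -, -, hχ1, hs, hg, -⟩ := hcut R hR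
  have hc := hasCompactSupport_of_subset_closedBall hs
  refine (setIntegral_le_integral_mul_sq hf hf0 hχ.continuous hc hχ1).trans
    ((h χ hχ hc).trans ?_)
  refine (mul_le_mul_of_nonneg_left
    (integral_gradSq_le_of_le hχ (by positivity) hs hg) hl.le).trans (le_of_eq ?_)
  rw [Real.rpow_sub hR, Real.rpow_natCast, Real.rpow_two, mul_pow]
  field_simp

lemma sq_sum_of_mul_eq_zero {ι : Type*} (s : Finset ι) (a : ι → ℝ)
    (h : ∀ i j, i ≠ j → a i * a j = 0) : (∑ i ∈ s, a i) ^ 2 = ∑ i ∈ s, a i ^ 2 := by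
  rw [sq, Finset.sum_mul_sum]
  refine Finset.sum_congr rfl fun i hi => ?_
  rw [Finset.sum_eq_single_of_mem i hi fun j _ hj => h i j hj.symm, sq]

lemma pd_const_mul_sum {χ : ℕ → Euc N → ℝ} (hχ : ∀ k, ContDiff ℝ 1 (χ k)) (c : ℝ) (n : ℕ)
    (i : Fin N) (x : Euc N) :
    pd i (fun y => c * ∑ k ∈ Finset.range n, χ k y) x =
      c * ∑ k ∈ Finset.range n, pd i (χ k) x := by
  have hd : ∀ k, DifferentiableAt ℝ (χ k) x := fun k => (hχ k).differentiable one_ne_zero x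
  simp only [pd]
  rw [fderiv_const_mul (DifferentiableAt.fun_sum fun k _ => hd k),
    fderiv_fun_sum fun k _ => hd k]
  simp

/-- Parabolicity of `ℝ^N` for `N ≤ 2`. -/
lemma false_of_hardy_of_le_two {f : Euc N → ℝ} {l : ℝ} (hN : N ≤ 2) (hf : Continuous f)
    (hf0 : ∀ x, 0 < f x) (hl : 0 < l)
    (h : ∀ φ : Euc N → ℝ, ContDiff ℝ 1 φ → HasCompactSupport φ →
      ∫ x, f x * φ x ^ 2 ≤ l * ∫ x, gradSq φ x) : False := by
  obtain ⟨B, hB, hcut⟩ := exists_cutoff N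
  choose! χ' hχ' using hcut
  have h4 : ∀ k : ℕ, (0 : ℝ) < 4 ^ k := fun k => by positivity
  set χ : ℕ → Euc N → ℝ := fun k => χ' (4 ^ k) with hχdef
  have hχ : ∀ k, ContDiff ℝ 1 (χ k) := fun k => (hχ' _ (h4 k)).1
  have hone : ∀ k x, ‖x‖ ≤ 4 ^ k → χ k x = 1 := fun k => (hχ' _ (h4 k)).2.2.2.1
  have hs : ∀ k, tsupport (χ k) ⊆ closedBall 0 (2 * 4 ^ k) := fun k => (hχ' _ (h4 k)).2.2.2.2.1
  have hg : ∀ k x, gradSq (χ k) x ≤ B / (4 ^ k) ^ 2 := fun k => (hχ' _ (h4 k)).2.2.2.2.2.1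
  have hz : ∀ k x, ‖x‖ < 4 ^ k → ∀ i, pd i (χ k) x = 0 := fun k => (hχ' _ (h4 k)).2.2.2.2.2.2
  set V := volume.real (closedBall (0 : Euc N) 1) with hV
  have hV0 : 0 ≤ V := measureReal_nonneg
  have hgk : ∀ k, ∫ x, gradSq (χ k) x ≤ 4 * B * V := fun k => by
    refine (integral_gradSq_le_of_le (hχ k) (by positivity) (hs k) (hg k)).trans ?_
    have h1 : (1 : ℝ) ≤ 2 * 4 ^ k := by linarith [one_le_pow₀ (show (1 : ℝ) ≤ 4 by norm_num) (n := k)]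
    calc B / (4 ^ k) ^ 2 * ((2 * 4 ^ k) ^ N * V) ≤ B / (4 ^ k) ^ 2 * ((2 * 4 ^ k) ^ 2 * V) := by
          gcongr
      _ = 4 * B * V := by field_simp; ring
  have hlt : ∀ j k x i, j < k → pd i (χ j) x * pd i (χ k) x = 0 := fun j k x i hjk => by
    by_cases hx : x ∈ tsupport (χ j)
    · have h1 : ‖x‖ ≤ 2 * 4 ^ j := by simpa using hs j hx
      have h2 : (4 : ℝ) ^ (j + 1) ≤ 4 ^ k := pow_le_pow_right₀ (by norm_num) hjk
      rw [hz k x (by rw [pow_succ] at h2; linarith [h4 j]) i, mul_zero]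
    · rw [pd_eq_zero hx, zero_mul]
  have hdisj : ∀ x i j k, j ≠ k → pd i (χ j) x * pd i (χ k) x = 0 := fun x i j k hjk => by
    rcases hjk.lt_or_gt with h' | h'
    · exact hlt j k x i h'
    · rw [mul_comm]; exact hlt k j x i h'
  have hc0 : 0 < ∫ x in closedBall (0 : Euc N) 1, f x := by
    rw [setIntegral_pos_iff_support_of_nonneg_ae (.of_forall fun x => (hf0 x).le)
      (hf.continuousOn.integrableOn_compact (isCompact_closedBall 0 1))]
    rw [show Function.support f = univ from eq_univ_of_forall fun x => (hf0 x).ne', univ_inter]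
    exact measure_closedBall_pos _ _ one_pos
  set c₀ := ∫ x in closedBall (0 : Euc N) 1, f x with hc₀
  have main : ∀ n : ℕ, 0 < n → c₀ * n ≤ l * (4 * B * V) := fun n hn => by
    have hn' : (0 : ℝ) < n := by exact_mod_cast hn
    set φ : Euc N → ℝ := fun y => (n : ℝ)⁻¹ * ∑ k ∈ Finset.range n, χ k y with hφdef
    have hφ : ContDiff ℝ 1 φ := contDiff_const.mul (ContDiff.sum fun k _ => hχ k)
    have hc : HasCompactSupport φ :=
      HasCompactSupport.intro (isCompact_closedBall 0 (2 * 4 ^ n)) fun x hx => by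
        simp only [hφdef]
        rw [Finset.sum_eq_zero, mul_zero]
        intro k hk
        refine image_eq_zero_of_notMem_tsupport fun h' => hx ?_
        refine closedBall_subset_closedBall ?_ (hs k h')
        have : (4 : ℝ) ^ k ≤ 4 ^ n := pow_le_pow_right₀ (by norm_num) (Finset.mem_range.1 hk).le
        linarith
    have h1 : ∀ x : Euc N, ‖x‖ ≤ 1 → φ x = 1 := fun x hx => by
      simp only [hφdef]
      rw [Finset.sum_congr rfl fun k _ => hone k x
        (hx.trans (one_le_pow₀ (show (1 : ℝ) ≤ 4 by norm_num)))]
      simp [hn'.ne']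
    have hgr : ∀ x, gradSq φ x = (n : ℝ)⁻¹ ^ 2 * ∑ k ∈ Finset.range n, gradSq (χ k) x := fun x => by
      simp only [gradSq, hφdef, pd_const_mul_sum hχ, mul_pow]
      rw [← Finset.mul_sum, Finset.sum_comm]
      congr 1
      exact Finset.sum_congr rfl fun i _ => sq_sum_of_mul_eq_zero _ _ (hdisj x i)
    have h2 := (setIntegral_le_integral_mul_sq hf (fun x => (hf0 x).le) hφ.continuous hc h1).trans
      (h φ hφ hc)
    simp only [hgr] at h2
    rw [integral_const_mul, integral_finsetSum _ fun k _ =>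
      integrable_gradSq (hχ k) (hasCompactSupport_of_subset_closedBall (hs k))] at h2
    have h3 : ∑ k ∈ Finset.range n, ∫ x, gradSq (χ k) x ≤ n * (4 * B * V) := by
      simpa using Finset.sum_le_card_nsmul (Finset.range n) _ _ fun k _ => hgk k
    have h4 : c₀ ≤ l * ((n : ℝ)⁻¹ ^ 2 * (n * (4 * B * V))) := h2.trans (by gcongr)
    calc c₀ * n ≤ l * ((n : ℝ)⁻¹ ^ 2 * (n * (4 * B * V))) * n := by gcongr
      _ = _ := by field_simp
  obtain ⟨n, hn⟩ := exists_nat_gt (l * (4 * B * V) / c₀)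
  have hn0 : (0 : ℝ) < n := lt_of_le_of_lt (by positivity) hn
  have := main n (by exact_mod_cast hn0)
  rw [div_lt_iff₀ hc0] at hn
  linarith

lemma false_of_five_roots {a b c : ℝ} {f : Fin 5 → ℝ} (hf : StrictMono f)
    (h : ∀ i, f i ^ 4 + a * f i ^ 2 + b * f i + c = 0) : False := by
  set P : Polynomial ℝ := .X ^ 4 + .C a * .X ^ 2 + .C b * .X + .C c with hP
  have hdeg : P.natDegree = 4 := by rw [hP]; compute_degree!
  have h0 := Polynomial.eq_zero_of_natDegree_lt_card_of_eval_eq_zero P hf.injective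
    (fun i => by simpa [hP] using h i) (by rw [hdeg]; simp)
  rw [h0] at hdeg
  simp at hdeg

lemma continuous_Gpoly (p q : ℝ) : Continuous (Gpoly p q) := by
  unfold Gpoly; fun_prop

lemma Gpoly_half {p q : ℝ} (hp : 0 < p) : Gpoly p q (1 / 2) = 1 / 16 := by
  unfold Gpoly; field_simp; ring

lemma Gpoly_half_add_one_neg {p q : ℝ} (hp : 0 < p) (hq : 0 < q)
    (h : (p + 1) * (q + 1) < 4 * (p * q)) : Gpoly p q ((q + 1) / 2) < 0 := by
  have e : Gpoly p q ((q + 1) / 2) =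
      (q + 1) ^ 2 / (p + 1) ^ 2 * ((((p + 1) * (q + 1)) ^ 2 - (4 * (p * q)) ^ 2) / 16) := by
    unfold Gpoly; field_simp; ring
  rw [e]
  refine mul_neg_of_pos_of_neg (by positivity) ?_
  have : ((p + 1) * (q + 1)) ^ 2 < (4 * (p * q)) ^ 2 := pow_lt_pow_left₀ h (by positivity) (by simp)
  linarith

lemma exists_Gpoly_pos {p q : ℝ} (hp : 0 < p) (hq : 0 < q) (s : ℝ) :
    ∃ M, s < M ∧ 0 < M ∧ 0 < Gpoly p q M ∧ 0 < Gpoly p q (-M) := by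
  set a := 4 * p * q * (q + 1) / (p + 1) with ha
  set b := 2 * p * q * (q + 1) * (p + q + 2) / (p + 1) ^ 2 with hb
  set c := p * q * (q + 1) ^ 2 / (p + 1) ^ 2 with hc
  have ha0 : 0 ≤ a := by positivity
  have hb0 : 0 ≤ b := by positivity
  have hc0 : 0 ≤ c := by positivity
  set M := 1 + a + b + c + |s| with hM
  have hs := le_abs_self s
  have hs0 := abs_nonneg s
  have hM1 : 1 ≤ M := by linarith
  have h1 : M ≤ M ^ 2 := by nlinarith
  have h2 : M ^ 2 ≤ M ^ 3 := by nlinarith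
  have h4 : M ^ 4 = M ^ 3 * (1 + a + b + c + |s|) := by rw [← hM]; ring
  have h5 : a * M ^ 2 ≤ a * M ^ 3 := by gcongr
  have h6 : b * M ≤ b * M ^ 3 := by gcongr; linarith
  have h7 : c ≤ c * M ^ 3 := le_mul_of_one_le_right hc0 (by linarith)
  have h8 : 0 ≤ |s| * M ^ 3 := by positivity
  have h9 : 0 ≤ b * M := by positivity
  have hpos : 0 < M ^ 4 - a * M ^ 2 - b * M - c := by rw [h4]; nlinarith
  refine ⟨M, by linarith, by linarith, ?_, ?_⟩
  · change 0 < M ^ 4 - a * M ^ 2 + b * M - c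
    linarith
  · change 0 < (-M) ^ 4 - a * (-M) ^ 2 + b * (-M) - c
    have : (-M) ^ 4 = M ^ 4 := by ring
    have : (-M) ^ 2 = M ^ 2 := by ring
    simp only [*]
    linarith

/-- `G` is negative between `(q + 1) / 2` and its largest root. -/
lemma Gpoly_neg_of_lt_root {p q z₀ t : ℝ} (hp : 0 < p) (hq : 0 < q)
    (h : (p + 1) * (q + 1) < 4 * (p * q)) (hroot : Gpoly p q z₀ = 0)
    (ht : (q + 1) / 2 < t) (htz : t < z₀) : Gpoly p q t < 0 := by
  by_contra! hcon
  have hG := continuous_Gpoly p q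
  have hneg := Gpoly_half_add_one_neg hp hq h
  have hhalf := Gpoly_half (q := q) hp
  have h0 : Gpoly p q 0 < 0 := by
    have : 0 < p * q * (q + 1) ^ 2 / (p + 1) ^ 2 := by positivity
    simp only [Gpoly]
    linarith
  obtain ⟨M, -, hM, -, hMpos⟩ := exists_Gpoly_pos hp hq 0
  obtain ⟨r₁, ⟨-, hr₁'⟩, e₁⟩ := intermediate_value_Icc' (by linarith : -M ≤ 0) hG.continuousOn
    (show (0 : ℝ) ∈ Icc _ _ from ⟨h0.le, hMpos.le⟩)
  obtain ⟨r₂, ⟨hr₂, hr₂'⟩, e₂⟩ := intermediate_value_Icc (by norm_num : (0 : ℝ) ≤ 1 / 2)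
    hG.continuousOn (show (0 : ℝ) ∈ Icc _ _ from ⟨h0.le, by rw [hhalf]; norm_num⟩)
  obtain ⟨r₃, ⟨hr₃, hr₃'⟩, e₃⟩ := intermediate_value_Icc' (by linarith : 1 / 2 ≤ (q + 1) / 2)
    hG.continuousOn (show (0 : ℝ) ∈ Icc _ _ from ⟨hneg.le, by rw [hhalf]; norm_num⟩)
  obtain ⟨r₄, ⟨hr₄, hr₄'⟩, e₄⟩ := intermediate_value_Icc ht.le
    hG.continuousOn (show (0 : ℝ) ∈ Icc _ _ from ⟨hneg.le, hcon⟩)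
  have l₁ : r₁ < r₂ := lt_of_le_of_ne (hr₁'.trans hr₂) fun e => by
    have : r₁ = 0 := by linarith
    rw [this] at e₁
    linarith
  have l₂ : r₂ < r₃ := lt_of_le_of_ne (hr₂'.trans hr₃) fun e => by
    have : r₂ = 1 / 2 := by linarith
    rw [this] at e₂
    linarith
  have l₃ : r₃ < r₄ := lt_of_le_of_ne (hr₃'.trans hr₄) fun e => by
    have : r₃ = (q + 1) / 2 := by linarith
    rw [this] at e₃
    linarith
  have l₄ : r₄ < z₀ := lt_of_le_of_lt hr₄' htz
  refine false_of_five_roots (f := ![r₁, r₂, r₃, r₄, z₀])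
    (a := -(4 * p * q * (q + 1) / (p + 1)))
    (b := 2 * p * q * (q + 1) * (p + q + 2) / (p + 1) ^ 2)
    (c := -(p * q * (q + 1) ^ 2 / (p + 1) ^ 2)) ?_ ?_
  · refine Fin.strictMono_iff_lt_succ.2 fun i => ?_
    fin_cases i
    exacts [l₁, l₂, l₃, l₄]
  · have key : ∀ x, Gpoly p q x = 0 → x ^ 4 + -(4 * p * q * (q + 1) / (p + 1)) * x ^ 2 +
        2 * p * q * (q + 1) * (p + q + 2) / (p + 1) ^ 2 * x +
        -(p * q * (q + 1) ^ 2 / (p + 1) ^ 2) = 0 := fun x hx => by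
      rw [← hx, Gpoly]; ring
    intro i
    fin_cases i
    exacts [key _ e₁, key _ e₂, key _ e₃, key _ e₄, key _ hroot]

lemma half_add_one_lt_root {p q z₀ : ℝ} (hp : 0 < p) (hq : 0 < q)
    (h : (p + 1) * (q + 1) < 4 * (p * q)) (hmax : ∀ z : ℝ, Gpoly p q z = 0 → z ≤ z₀) :
    (q + 1) / 2 < z₀ := by
  have hneg := Gpoly_half_add_one_neg hp hq h
  obtain ⟨M, hM, -, hMpos, -⟩ := exists_Gpoly_pos hp hq ((q + 1) / 2)
  obtain ⟨r, ⟨hr, -⟩, e⟩ := intermediate_value_Icc hM.le (continuous_Gpoly p q).continuousOn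
    (show (0 : ℝ) ∈ Icc _ _ from ⟨hneg.le, hMpos.le⟩)
  refine lt_of_lt_of_le (lt_of_le_of_ne hr fun e' => ?_) (hmax r e)
  rw [← e'] at e
  linarith

lemma sq_mul_sq_lt_of_Gpoly_neg {p q t r : ℝ} (hp : 0 < p) (hq : 0 < q)
    (hr : r * (q + 1) = t * (p + 1)) (h : Gpoly p q t < 0) :
    t ^ 2 * r ^ 2 < p * q * ((2 * t - 1) * (2 * r - 1)) := by
  have hr' : r = t * (p + 1) / (q + 1) := by rw [← hr]; field_simp
  have e : t ^ 2 * r ^ 2 - p * q * ((2 * t - 1) * (2 * r - 1)) =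
      (p + 1) ^ 2 / (q + 1) ^ 2 * Gpoly p q t := by
    rw [hr']; unfold Gpoly; field_simp; ring
  have : (p + 1) ^ 2 / (q + 1) ^ 2 * Gpoly p q t < 0 := mul_neg_of_pos_of_neg (by positivity) h
  linarith

lemma exists_weights {a b m : ℝ} (ha : 0 < a) (hb : 0 < b) (h : a * b < m) :
    ∃ K c : ℝ, 0 < c ∧ a < K ∧ b < K * c ^ 2 ∧ K * c < √m := by
  have hs : √(a * b) < √m := Real.sqrt_lt_sqrt (by positivity) h
  have hs0 : 0 < √(a * b) := Real.sqrt_pos.2 (by positivity)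
  obtain ⟨s, hs1, hs2⟩ := exists_between ((one_lt_div hs0).2 hs)
  rw [lt_div_iff₀ hs0] at hs2
  have hab : √(a * b) ^ 2 = a * b := Real.sq_sqrt (by positivity)
  refine ⟨a * s, √(a * b) / a, by positivity, by nlinarith, ?_, ?_⟩
  · rw [div_pow, hab]
    have : a * s * (a * b / a ^ 2) = s * b := by field_simp
    rw [this]
    nlinarith
  · have : a * s * (√(a * b) / a) = s * √(a * b) := by field_simp
    rwa [this]

/-- A rearrangement inequality for powers. -/
lemma rpow_rearrangement {x y c p q t r : ℝ} (hx : 0 < x) (hy : 0 < y) (hc : 0 < c) (hp : 0 < p)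
    (hq : 0 < q) (hr : r * (q + 1) = t * (p + 1)) (ht : q + 1 ≤ 4 * t) :
    c ^ (4 * t / (q + 1) - 1) * (y ^ p * x ^ (2 * t - 1)) + c * (x ^ q * y ^ (2 * r - 1)) ≤
      x ^ ((q - 1) / 2) * y ^ ((p - 1) / 2) *
        (c ^ (4 * t / (q + 1)) * x ^ (2 * t) + y ^ (2 * r)) := by
  set k := 4 * t / (q + 1) with hk
  have hk1 : 1 ≤ k := (one_le_div (by linarith)).2 ht
  have hkt : (q + 1) / 2 * k = 2 * t := by rw [hk]; field_simp; ring
  have hkr : (p + 1) / 2 * k = 2 * r := by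
    have hr' : r = t * (p + 1) / (q + 1) := by rw [← hr]; field_simp
    rw [hk, hr']; field_simp; ring
  set X := x ^ ((q + 1) / 2) with hX
  set Y := y ^ ((p + 1) / 2) with hY
  have hX0 : 0 < X := by positivity
  have hY0 : 0 < Y := by positivity
  have e1 : x ^ (2 * t) = X ^ k := by rw [hX, ← Real.rpow_mul hx.le, hkt]
  have e2 : y ^ (2 * r) = Y ^ k := by rw [hY, ← Real.rpow_mul hy.le, hkr]
  have e3 : x ^ (2 * t - 1) = X ^ k / x := by rw [Real.rpow_sub_one hx.ne', e1]
  have e4 : y ^ (2 * r - 1) = Y ^ k / y := by rw [Real.rpow_sub_one hy.ne', e2]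
  have e5 : x ^ ((q - 1) / 2) = X / x := by
    rw [hX, ← Real.rpow_sub_one hx.ne']; congr 1; ring
  have e6 : y ^ ((p - 1) / 2) = Y / y := by
    rw [hY, ← Real.rpow_sub_one hy.ne']; congr 1; ring
  have e7 : x ^ q = X ^ 2 / x := by
    rw [hX, ← Real.rpow_natCast, ← Real.rpow_mul hx.le, ← Real.rpow_sub_one hx.ne']
    congr 1; push_cast; ring
  have e8 : y ^ p = Y ^ 2 / y := by
    rw [hY, ← Real.rpow_natCast, ← Real.rpow_mul hy.le, ← Real.rpow_sub_one hy.ne']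
    congr 1; push_cast; ring
  have e9 : X ^ k = X ^ (k - 1) * X := by rw [← Real.rpow_add_one hX0.ne']; ring_nf
  have e10 : Y ^ k = Y ^ (k - 1) * Y := by rw [← Real.rpow_add_one hY0.ne']; ring_nf
  have e11 : c ^ k = c ^ (k - 1) * c := by rw [← Real.rpow_add_one hc.ne']; ring_nf
  have e12 : (c * X) ^ (k - 1) = c ^ (k - 1) * X ^ (k - 1) := Real.mul_rpow hc.le hX0.le
  have key : 0 ≤ (c * X - Y) * ((c * X) ^ (k - 1) - Y ^ (k - 1)) := by
    rcases le_total Y (c * X) with h | h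
    · exact mul_nonneg (by linarith)
        (sub_nonneg.2 (Real.rpow_le_rpow hY0.le h (by linarith)))
    · exact mul_nonneg_of_nonpos_of_nonpos (by linarith)
        (sub_nonpos.2 (Real.rpow_le_rpow (by positivity) h (by linarith)))
  rw [e12] at key
  rw [e1, e2, e3, e4, e5, e6, e7, e8, e9, e10, e11]
  have e : X / x * (Y / y) * (c ^ (k - 1) * c * (X ^ (k - 1) * X) + Y ^ (k - 1) * Y) -
      (c ^ (k - 1) * (Y ^ 2 / y * (X ^ (k - 1) * X / x)) +
        c * (X ^ 2 / x * (Y ^ (k - 1) * Y / y))) =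
      X * Y / (x * y) * ((c * X - Y) * (c ^ (k - 1) * X ^ (k - 1) - Y ^ (k - 1))) := by
    field_simp
    ring
  have : 0 ≤ X * Y / (x * y) * ((c * X - Y) * (c ^ (k - 1) * X ^ (k - 1) - Y ^ (k - 1))) :=
    mul_nonneg (by positivity) key
  linarith

lemma contDiff_rpow_mul {w η : Euc N → ℝ} (hw : ContDiff ℝ 1 w) (hw0 : ∀ x, 0 < w x)
    (hη : ContDiff ℝ 1 η) (t : ℝ) : ContDiff ℝ 1 fun x => w x ^ t * η x :=
  (hw.rpow_const_of_ne fun x => (hw0 x).ne').mul hη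

/-- The energy estimate for stable solutions. -/
lemma exists_energy_le {p q t r l : ℝ} {u v : Euc N → ℝ} (hp : 0 < p) (hq : 0 < q)
    (hu : ContDiff ℝ 2 u) (hv : ContDiff ℝ 2 v) (hu0 : ∀ x, 0 < u x) (hv0 : ∀ x, 0 < v x)
    (h1 : ∀ x, -lap u x = v x ^ p) (h2 : ∀ x, -lap v x = u x ^ q) (hl : 0 < l)
    (hcomp : ∀ x, v x ≤ l * u x ^ ((q + 1) / (p + 1)))
    (hst : ∀ φ : Euc N → ℝ, ContDiff ℝ 1 φ → HasCompactSupport φ →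
      √(p * q) * ∫ x, u x ^ ((q - 1) / 2) * v x ^ ((p - 1) / 2) * φ x ^ 2 ≤ ∫ x, gradSq φ x)
    (ht : 1 / 2 < t) (hr : 1 / 2 < r) (hrt : r * (q + 1) = t * (p + 1)) (hqt : q + 1 ≤ 4 * t)
    (hG : t ^ 2 * r ^ 2 < p * q * ((2 * t - 1) * (2 * r - 1))) :
    ∃ C : ℝ, 0 < C ∧ ∀ η : Euc N → ℝ, ContDiff ℝ 1 η → HasCompactSupport η →
      ∫ x, gradSq (fun y => u y ^ t * η y) x ≤ C * ∫ x, u x ^ (2 * t) * gradSq η x := by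
  have ht' : 0 < 2 * t - 1 := by linarith
  have hr' : 0 < 2 * r - 1 := by linarith
  have hprod : t ^ 2 / (2 * t - 1) * (r ^ 2 / (2 * r - 1)) < p * q := by
    rwa [div_mul_div_comm, div_lt_iff₀ (by positivity)]
  obtain ⟨K, c, hc, hK1, hK2, hKc⟩ := exists_weights (a := t ^ 2 / (2 * t - 1))
    (b := r ^ 2 / (2 * r - 1)) (by positivity) (by positivity) hprod
  have hK0 : 0 < K := lt_trans (by positivity) hK1
  set k := 4 * t / (q + 1) with hk
  set C₁ := 1 + (K - t) ^ 2 / (K * (2 * t - 1) - t ^ 2) with hC₁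
  set C₂ := 1 + (K * c ^ 2 - r) ^ 2 / (K * c ^ 2 * (2 * r - 1) - r ^ 2) with hC₂
  have hC₁0 : 0 < C₁ := by
    have := (div_lt_iff₀ ht').1 hK1
    have : 0 ≤ (K - t) ^ 2 / (K * (2 * t - 1) - t ^ 2) :=
      div_nonneg (sq_nonneg _) (by linarith)
    linarith
  have hC₂0 : 0 < C₂ := by
    have := (div_lt_iff₀ hr').1 hK2
    have : 0 ≤ (K * c ^ 2 - r) ^ 2 / (K * c ^ 2 * (2 * r - 1) - r ^ 2) :=
      div_nonneg (sq_nonneg _) (by linarith)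
    linarith
  have hgap : 0 < √(p * q) - K * c := by linarith
  have hs0 : 0 < √(p * q) := Real.sqrt_pos.2 (by positivity)
  set C := √(p * q) * (c ^ k * C₁ + C₂ * l ^ (2 * r)) / ((√(p * q) - K * c) * c ^ k) with hC
  refine ⟨C, by positivity, fun η hη hηc => ?_⟩
  have hu1 : ContDiff ℝ 1 u := hu.of_le (by norm_num)
  have hv1 : ContDiff ℝ 1 v := hv.of_le (by norm_num)
  have cu : ∀ s : ℝ, Continuous fun x => u x ^ s := fun s =>
    hu.continuous.rpow_const fun x => Or.inl (hu0 x).ne'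
  have cv : ∀ s : ℝ, Continuous fun x => v x ^ s := fun s =>
    hv.continuous.rpow_const fun x => Or.inl (hv0 x).ne'
  have cη := hη.continuous
  have cg := continuous_gradSq hη
  have E1 := integral_gradSq_rpow_mul_le hu hu0 hη hηc ht hK1
  have E2 := integral_gradSq_rpow_mul_le hv hv0 hη hηc hr hK2
  have S1 := hst _ (contDiff_rpow_mul hu1 hu0 hη t) hηc.mul_left
  have S2 := hst _ (contDiff_rpow_mul hv1 hv0 hη r) hηc.mul_left
  simp only [h1] at E1
  simp only [h2] at E2
  rw [← hC₁] at E1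
  rw [← hC₂] at E2
  set L := ∫ x, u x ^ (2 * t) * gradSq η x with hL
  set L₂ := ∫ x, v x ^ (2 * r) * gradSq η x with hL₂
  set A := ∫ x, v x ^ p * (u x ^ (2 * t - 1) * η x ^ 2) with hA
  set B := ∫ x, u x ^ q * (v x ^ (2 * r - 1) * η x ^ 2) with hB
  set D₁ := ∫ x, gradSq (fun y => u y ^ t * η y) x with hD₁
  set D₂ := ∫ x, gradSq (fun y => v y ^ r * η y) x with hD₂
  set I₁ := ∫ x, u x ^ ((q - 1) / 2) * v x ^ ((p - 1) / 2) * (u x ^ t * η x) ^ 2 with hI₁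
  set I₂ := ∫ x, u x ^ ((q - 1) / 2) * v x ^ ((p - 1) / 2) * (v x ^ r * η x) ^ 2 with hI₂
  have hD₂0 : 0 ≤ D₂ := integral_nonneg fun x => gradSq_nonneg _ x
  have hLL : L₂ ≤ l ^ (2 * r) * L := by
    rw [hL, hL₂, ← integral_const_mul]
    refine integral_mono (integrable_of_eq_zero_off (by fun_prop) hηc fun x hx => by
      simp [gradSq_eq_zero hx]) ((integrable_of_eq_zero_off (by fun_prop) hηc fun x hx => by
      simp [gradSq_eq_zero hx]).const_mul _) fun x => ?_
    have hux := hu0 x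
    have : v x ^ (2 * r) ≤ l ^ (2 * r) * u x ^ (2 * t) := by
      refine (Real.rpow_le_rpow (hv0 x).le (hcomp x) (by linarith)).trans (le_of_eq ?_)
      rw [Real.mul_rpow hl.le (by positivity), ← Real.rpow_mul hux.le]
      congr 2
      field_simp
      linarith
    have := mul_le_mul_of_nonneg_right this (gradSq_nonneg η x)
    simp only
    linarith
  have hTS : c ^ (k - 1) * A + c * B ≤ c ^ k * I₁ + I₂ := by
    have z : ∀ x, x ∉ tsupport η → η x = 0 := fun x hx => image_eq_zero_of_notMem_tsupport hx
    have iA : Integrable fun x => v x ^ p * (u x ^ (2 * t - 1) * η x ^ 2) :=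
      integrable_of_eq_zero_off (by fun_prop) hηc fun x hx => by simp [z x hx]
    have iB : Integrable fun x => u x ^ q * (v x ^ (2 * r - 1) * η x ^ 2) :=
      integrable_of_eq_zero_off (by fun_prop) hηc fun x hx => by simp [z x hx]
    have i1 : Integrable fun x =>
        u x ^ ((q - 1) / 2) * v x ^ ((p - 1) / 2) * (u x ^ t * η x) ^ 2 :=
      integrable_of_eq_zero_off (by fun_prop) hηc fun x hx => by simp [z x hx]
    have i2 : Integrable fun x =>
        u x ^ ((q - 1) / 2) * v x ^ ((p - 1) / 2) * (v x ^ r * η x) ^ 2 :=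
      integrable_of_eq_zero_off (by fun_prop) hηc fun x hx => by simp [z x hx]
    rw [hA, hB, hI₁, hI₂, ← integral_const_mul, ← integral_const_mul, ← integral_const_mul,
      ← integral_add (iA.const_mul _) (iB.const_mul _), ← integral_add (i1.const_mul _) i2]
    refine integral_mono ((iA.const_mul _).add (iB.const_mul _)) ((i1.const_mul _).add i2)
      fun x => ?_
    have e1 : (u x ^ t) ^ 2 = u x ^ (2 * t) := by
      rw [mul_comm, Real.rpow_mul (hu0 x).le, Real.rpow_two]
    have e2 : (v x ^ r) ^ 2 = v x ^ (2 * r) := by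
      rw [mul_comm, Real.rpow_mul (hv0 x).le, Real.rpow_two]
    have := mul_le_mul_of_nonneg_right
      (rpow_rearrangement (hu0 x) (hv0 x) hc hp hq hrt hqt) (sq_nonneg (η x))
    simp only [mul_pow, e1, e2]
    linarith
  have hck : c ^ k = c ^ (k - 1) * c := by rw [← Real.rpow_add_one hc.ne']; ring_nf
  have hckp : 0 < c ^ k := by positivity
  have k1 : c ^ k * D₁ + D₂ ≤ K * c * (c ^ (k - 1) * A + c * B) +
      (c ^ k * C₁ + C₂ * l ^ (2 * r)) * L := by
    have a1 := mul_le_mul_of_nonneg_left E1 hckp.le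
    have a2 := mul_le_mul_of_nonneg_left hLL hC₂0.le
    have a3 : c ^ k * (K * A) = K * c * (c ^ (k - 1) * A) := by rw [hck]; ring
    linarith
  have k2 : √(p * q) * (c ^ k * I₁ + I₂) ≤ c ^ k * D₁ + D₂ := by
    have a1 := mul_le_mul_of_nonneg_left S1 hckp.le
    linarith
  have k3 : √(p * q) * (c ^ (k - 1) * A + c * B) ≤ c ^ k * D₁ + D₂ :=
    (mul_le_mul_of_nonneg_left hTS hs0.le).trans k2
  have hKc0 : 0 < K * c := by positivity
  generalize c ^ (k - 1) * A + c * B = T at *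
  generalize √(p * q) = s at *
  have k4 : (s - K * c) * (c ^ k * D₁ + D₂) ≤ s * (c ^ k * C₁ + C₂ * l ^ (2 * r)) * L := by
    have b1 := mul_le_mul_of_nonneg_left k3 hKc0.le
    have b2 := mul_le_mul_of_nonneg_left k1 hs0.le
    linarith
  have k5 : (s - K * c) * c ^ k * D₁ ≤ s * (c ^ k * C₁ + C₂ * l ^ (2 * r)) * L := by
    have := mul_nonneg hgap.le hD₂0
    linarith
  rw [hC, div_mul_eq_mul_div, le_div_iff₀ (by positivity)]
  linarith

lemma integrableOn_closedBall_of_continuous {f : Euc N → ℝ} {r : ℝ} (hf : Continuous f) :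
    IntegrableOn f (closedBall 0 r) :=
  hf.continuousOn.integrableOn_compact (isCompact_closedBall 0 r)

lemma setIntegral_rpow_mul_rpow_le {F G : Euc N → ℝ} {K : Set (Euc N)} {a b : ℝ}
    (hK : IsCompact K) (hF : Continuous F) (hG : Continuous G) (hF0 : ∀ x, 0 ≤ F x)
    (hG0 : ∀ x, 0 ≤ G x) (ha : 0 < a) (hb : 0 < b) (hab : a + b = 1) :
    ∫ x in K, F x ^ a * G x ^ b ≤ (∫ x in K, F x) ^ a * (∫ x in K, G x) ^ b := by
  have : Fact (volume K < ⊤) := ⟨hK.measure_lt_top⟩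
  have mem : ∀ {H : Euc N → ℝ} {c : ℝ}, Continuous H → 0 < c → ∀ s : ENNReal,
      MemLp (fun x => H x ^ c) s (volume.restrict K) := fun {H c} hH hc s => by
    have hcont : Continuous fun x => H x ^ c := hH.rpow_const fun x => Or.inr hc.le
    obtain ⟨b, hb⟩ := hK.exists_bound_of_continuousOn hcont.continuousOn
    exact MemLp.of_bound hcont.aestronglyMeasurable b (ae_restrict_of_forall_mem hK.measurableSet hb)
  have := integral_mul_le_Lp_mul_Lq_of_nonneg (μ := volume.restrict K)
    (Real.holderConjugate_one_div ha hb hab)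
    (.of_forall fun x => Real.rpow_nonneg (hF0 x) a)
    (.of_forall fun x => Real.rpow_nonneg (hG0 x) b) (mem hF ha _) (mem hG hb _)
  have e : ∀ {y c : ℝ}, 0 ≤ y → 0 < c → (y ^ c) ^ (1 / c) = y := fun hy hc => by
    rw [← Real.rpow_mul hy, mul_one_div_cancel hc.ne', Real.rpow_one]
  simpa only [e (hF0 _) ha, e (hG0 _) hb, one_div_one_div] using this

lemma gradSq_rpow {χ : Euc N → ℝ} {M : ℝ} (hχ : ContDiff ℝ 1 χ) (hχ0 : ∀ x, 0 ≤ χ x) (hM : 1 ≤ M)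
    (x : Euc N) :
    gradSq (fun y => χ y ^ M) x = M ^ 2 * χ x ^ (2 * M - 2) * gradSq χ x := by
  have e : (χ x ^ (M - 1)) ^ 2 = χ x ^ (2 * M - 2) := by
    rw [← Real.rpow_two, ← Real.rpow_mul (hχ0 x)]; congr 1; ring
  simp only [gradSq]
  rw [Finset.mul_sum]
  refine Finset.sum_congr rfl fun i _ => ?_
  rw [pd_comp (Real.hasDerivAt_rpow_const (Or.inr hM)) (hχ.differentiable one_ne_zero x) i,
    mul_pow, mul_pow, e]

lemma energy_bound_of_cutoff {u χ : Euc N → ℝ} {t κ M C₁ b r s a e : ℝ} (hM : 1 < M)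
    (hs : 0 < s) (ha : 0 < a) (he : 0 < e) (hae : a + e = 1) (hsa : s * a = 2 - 2 / M)
    (hκe : κ * e = 2 * t / M) (hu : ContDiff ℝ 1 u) (hu0 : ∀ x, 0 < u x) (hC₁ : 0 < C₁)
    (hen : ∀ η : Euc N → ℝ, ContDiff ℝ 1 η → HasCompactSupport η →
      ∫ x, gradSq (fun y => u y ^ t * η y) x ≤ C₁ * ∫ x, u x ^ (2 * t) * gradSq η x)
    (hχ : ContDiff ℝ 1 χ) (hχ0 : ∀ x, 0 ≤ χ x) (hsup : tsupport χ ⊆ closedBall 0 r)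
    (hb : ∀ x, gradSq χ x ≤ b) (hb0 : 0 ≤ b) :
    ∫ x, gradSq (fun y => u y ^ t * χ y ^ M) x ≤ C₁ * (M ^ 2 * b *
      ((∫ x, (u x ^ t * χ x ^ M) ^ s) ^ a * (∫ x in closedBall 0 r, u x ^ κ) ^ e)) := by
  have hM0 : 0 < M := by linarith
  have hη : ContDiff ℝ 1 fun x => χ x ^ M :=
    hχ.rpow_const_of_le (m := 1) (by exact_mod_cast hM.le)
  have hz : ∀ x, x ∉ closedBall (0 : Euc N) r → χ x = 0 := fun x hx =>
    image_eq_zero_of_notMem_tsupport fun h => hx (hsup h)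
  have hηc : HasCompactSupport fun x => χ x ^ M :=
    HasCompactSupport.intro (isCompact_closedBall 0 r) fun x hx => by
      rw [hz x hx, Real.zero_rpow hM0.ne']
  refine (hen _ hη hηc).trans (mul_le_mul_of_nonneg_left ?_ hC₁.le)
  have cu : ∀ c : ℝ, Continuous fun x => u x ^ c := fun c =>
    hu.continuous.rpow_const fun x => Or.inl (hu0 x).ne'
  have cF : Continuous fun x => (u x ^ t * χ x ^ M) ^ s :=
    ((cu t).mul hη.continuous).rpow_const fun x => Or.inr hs.le
  have F0 : ∀ x, 0 ≤ (u x ^ t * χ x ^ M) ^ s := fun x =>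
    Real.rpow_nonneg (mul_nonneg (Real.rpow_nonneg (hu0 x).le _) (Real.rpow_nonneg (hχ0 x) _)) _
  have hol := setIntegral_rpow_mul_rpow_le (isCompact_closedBall (0 : Euc N) r) cF (cu κ) F0
    (fun x => Real.rpow_nonneg (hu0 x).le _) ha he hae
  rw [setIntegral_eq_integral_of_forall_compl_eq_zero (s := closedBall (0 : Euc N) r)
    (f := fun x => (u x ^ t * χ x ^ M) ^ s) fun x hx => by
      rw [hz x hx, Real.zero_rpow hM0.ne', mul_zero, Real.zero_rpow hs.ne']] at hol
  refine le_trans ?_ (mul_le_mul_of_nonneg_left hol (by positivity))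
  have cχ : Continuous fun x => χ x ^ (2 * M - 2) :=
    hχ.continuous.rpow_const fun x => Or.inr (by linarith)
  have cg := continuous_gradSq hη
  have cu2 := cu (2 * t)
  have hpt : ∀ x, ((u x ^ t * χ x ^ M) ^ s) ^ a * (u x ^ κ) ^ e =
      u x ^ (2 * t) * χ x ^ (2 * M - 2) := fun x => by
    have hux := hu0 x
    have hχM := Real.rpow_nonneg (hχ0 x) M
    rw [← Real.rpow_mul (by positivity), ← Real.rpow_mul hux.le, hsa, hκe,
      Real.mul_rpow (by positivity) hχM, ← Real.rpow_mul hux.le, ← Real.rpow_mul (hχ0 x),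
      mul_right_comm, ← Real.rpow_add hux]
    congr 2 <;> (field_simp; try ring)
  simp only [hpt]
  rw [← integral_const_mul, ← setIntegral_eq_integral_of_forall_compl_eq_zero
    (s := closedBall (0 : Euc N) r) (f := fun x => u x ^ (2 * t) * gradSq (fun y => χ y ^ M) x)
    fun x hx => by
      rw [gradSq_rpow hχ hχ0 hM.le, gradSq_eq_zero fun h => hx (hsup h), mul_zero, mul_zero]]
  refine integral_mono (integrableOn_closedBall_of_continuous (by fun_prop))
    (integrableOn_closedBall_of_continuous (by fun_prop)) fun x => ?_
  simp only [gradSq_rpow hχ hχ0 hM.le]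
  have hux := hu0 x
  have h1 := Real.rpow_nonneg (hχ0 x) (2 * M - 2)
  calc _ ≤ u x ^ (2 * t) * (M ^ 2 * χ x ^ (2 * M - 2) * b) := by
        have := hb x
        gcongr
    _ = _ := by ring

/-- Liouville-type conclusion from the energy estimate, in dimension at least three. -/
lemma false_of_energy {u : Euc N → ℝ} {t κ C₁ C₂ : ℝ} (hN : 3 ≤ N) (hκ : 0 < κ) (ht : κ < 2 * t)
    (hd : ((N : ℝ) - 2) * κ < 4 * t) (hu : ContDiff ℝ 1 u) (hu0 : ∀ x, 0 < u x) (hC₁ : 0 < C₁)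
    (hen : ∀ η : Euc N → ℝ, ContDiff ℝ 1 η → HasCompactSupport η →
      ∫ x, gradSq (fun y => u y ^ t * η y) x ≤ C₁ * ∫ x, u x ^ (2 * t) * gradSq η x)
    (hC₂ : 0 ≤ C₂) (hJ : ∀ R : ℝ, 0 < R →
      ∫ x in closedBall 0 R, u x ^ κ ≤ C₂ * R ^ ((N : ℝ) - 2)) : False := by
  obtain ⟨S, hS, hsob⟩ := exists_sobolev_const hN
  obtain ⟨B, hB, hcut⟩ := exists_cutoff N
  have hn : (3 : ℝ) ≤ N := by exact_mod_cast hN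
  generalize hnN : (N : ℝ) = n at *
  have hn2 : 0 < n - 2 := by linarith
  have hn0 : 0 < n := by linarith
  set M := t * n / κ - (n - 2) / 2 with hMdef
  have hMκ : 2 * M * κ = 2 * t * n - (n - 2) * κ := by rw [hMdef]; field_simp
  have hM1 : 1 < M := by
    by_contra! h
    nlinarith
  have hM0 : 0 < M := by linarith
  have hM4 : (n - 2) ^ 2 < 4 * M := by
    by_contra! h
    nlinarith
  set s := 2 * n / (n - 2) with hs
  have hs0 : 0 < s := by positivity
  set θ := (n - 2) / n with hθ
  have hθ0 : 0 < θ := by positivity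
  set a := (1 - 1 / M) * θ with ha
  have hM2 : 0 < 1 - 1 / M := by
    rw [sub_pos, div_lt_one hM0]; exact hM1
  have ha0 : 0 < a := by positivity
  set e := (2 + (n - 2) / M) / n with he
  have he0 : 0 < e := by positivity
  have hae : a + e = 1 := by rw [ha, he, hθ]; field_simp; ring
  have hsa : s * a = 2 - 2 / M := by rw [hs, ha, hθ]; field_simp
  have hκe : κ * e = 2 * t / M := by rw [he]; field_simp; linarith
  set δ := 2 - (n - 2) * e with hδ
  have hδ0 : 0 < δ := by
    have : δ = (4 * M - (n - 2) ^ 2) / (n * M) := by rw [hδ, he]; field_simp; ring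
    rw [this]
    exact div_pos (by linarith) (by positivity)
  have cu : ∀ c : ℝ, Continuous fun x => u x ^ c := fun c =>
    hu.continuous.rpow_const fun x => Or.inl (hu0 x).ne'
  have hc0 : 0 < ∫ x in closedBall (0 : Euc N) 1, u x ^ (t * s) := by
    rw [setIntegral_pos_iff_support_of_nonneg_ae
      (.of_forall fun x => (Real.rpow_pos_of_pos (hu0 x) _).le)
      (integrableOn_closedBall_of_continuous (cu _)),
      show Function.support (fun x => u x ^ (t * s)) = univ from
        eq_univ_of_forall fun x => (Real.rpow_pos_of_pos (hu0 x) _).ne', univ_inter]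
    exact measure_closedBall_pos _ _ one_pos
  set c₀ := ∫ x in closedBall (0 : Euc N) 1, u x ^ (t * s) with hc₀
  have main : ∀ R : ℝ, 1 ≤ R →
      c₀ ^ (θ / M) ≤ S * C₁ * M ^ 2 * B * (C₂ * 2 ^ (n - 2)) ^ e * R ^ (-δ) := by
    intro R hR
    have hR0 : 0 < R := by linarith
    obtain ⟨χ, hχ, hχ0, -, hχ1, hsup, hg, -⟩ := hcut R hR0
    have hE := energy_bound_of_cutoff hM1 hs0 ha0 he0 hae hsa hκe hu hu0 hC₁ hen hχ hχ0 hsup hg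
      (by positivity)
    have hη : ContDiff ℝ 1 fun x => χ x ^ M :=
      hχ.rpow_const_of_le (m := 1) (by exact_mod_cast hM1.le)
    have hz : ∀ x, x ∉ closedBall (0 : Euc N) (2 * R) → χ x ^ M = 0 := fun x hx => by
      rw [image_eq_zero_of_notMem_tsupport fun h => hx (hsup h), Real.zero_rpow hM0.ne']
    have hηc : HasCompactSupport fun x => χ x ^ M :=
      HasCompactSupport.intro (isCompact_closedBall 0 (2 * R)) hz
    have hF0 : ∀ x, 0 ≤ u x ^ t * χ x ^ M := fun x =>
      mul_nonneg (Real.rpow_nonneg (hu0 x).le _) (Real.rpow_nonneg (hχ0 x) _)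
    have hSo := hsob _ (contDiff_rpow_mul hu hu0 hη t) hηc.mul_left
    simp only [abs_of_nonneg (hF0 _)] at hSo
    have hFint : Integrable fun x => (u x ^ t * χ x ^ M) ^ s := by
      refine Continuous.integrable_of_hasCompactSupport
        (((cu t).mul hη.continuous).rpow_const fun x => Or.inr hs0.le)
        (HasCompactSupport.intro (isCompact_closedBall 0 (2 * R)) fun x hx => ?_)
      rw [hz x hx, mul_zero, Real.zero_rpow hs0.ne']
    have hcF : c₀ ≤ ∫ x, (u x ^ t * χ x ^ M) ^ s := by
      calc c₀ = ∫ x in closedBall (0 : Euc N) 1, (u x ^ t * χ x ^ M) ^ s := by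
            refine setIntegral_congr_fun measurableSet_closedBall fun x hx => ?_
            have hx' : ‖x‖ ≤ R := (by simpa using hx : ‖x‖ ≤ 1).trans hR
            simp only [hχ1 x hx', Real.one_rpow, mul_one, ← Real.rpow_mul (hu0 x).le]
        _ ≤ _ := setIntegral_le_integral hFint (.of_forall fun x => Real.rpow_nonneg (hF0 x) _)
    set F := ∫ x, (u x ^ t * χ x ^ M) ^ s with hF
    have hFpos : 0 < F := hc0.trans_le hcF
    have hJR : (∫ x in closedBall (0 : Euc N) (2 * R), u x ^ κ) ^ e ≤
        (C₂ * 2 ^ (n - 2)) ^ e * R ^ ((n - 2) * e) := by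
      have h1 := Real.rpow_le_rpow (integral_nonneg fun x => Real.rpow_nonneg (hu0 x).le κ)
        (hJ (2 * R) (by positivity)) he0.le
      rwa [Real.mul_rpow two_pos.le hR0.le, ← mul_assoc,
        Real.mul_rpow (by positivity) (by positivity), ← Real.rpow_mul hR0.le] at h1
    have hR2 : R ^ (-δ) = R ^ ((n - 2) * e) / R ^ 2 := by
      rw [← Real.rpow_two, ← Real.rpow_sub hR0]; congr 1; rw [hδ]; ring
    have hθa : F ^ θ = F ^ a * F ^ (θ / M) := by
      rw [← Real.rpow_add hFpos]; congr 1; rw [ha]; field_simp; ring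
    have hFa : 0 < F ^ a := by positivity
    have h2 : F ^ a * F ^ (θ / M) ≤
        F ^ a * (S * C₁ * M ^ 2 * B * (C₂ * 2 ^ (n - 2)) ^ e * R ^ (-δ)) := by
      rw [← hθa, hR2]
      refine (hSo.trans (mul_le_mul_of_nonneg_left hE hS.le)).trans ?_
      calc _ ≤ S * (C₁ * (M ^ 2 * (B / R ^ 2) * (F ^ a *
            ((C₂ * 2 ^ (n - 2)) ^ e * R ^ ((n - 2) * e))))) := by gcongr
        _ = _ := by field_simp
    exact (Real.rpow_le_rpow hc0.le hcF (by positivity)).trans (le_of_mul_le_mul_left h2 hFa)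
  have hlim := (tendsto_rpow_neg_atTop hδ0).const_mul
    (S * C₁ * M ^ 2 * B * (C₂ * 2 ^ (n - 2)) ^ e)
  have hle := ge_of_tendsto hlim ((Filter.eventually_ge_atTop 1).mono main)
  have : 0 < c₀ ^ (θ / M) := by positivity
  linarith

end Auxiliary

/-- Theorem 1.8: for `p ≥ q > 1/3`, `p > (q+1)/(3q-1)` and `N < 2αz₀ + 2`, the Lane–Emden
system admits no positive `C²` solution stable in every bounded open subset of `ℝ^N`. -/
theorem stmt_6 (N : ℕ) (hN : 0 < N) (p q : ℝ)
    (hq : 1 / 3 < q) (hqp : q ≤ p) (hp' : (q + 1) / (3 * q - 1) < p)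
    (z₀ : ℝ) (hroot : Gpoly p q z₀ = 0) (hmax : ∀ z : ℝ, Gpoly p q z = 0 → z ≤ z₀)
    (hdim : (N : ℝ) < 2 * (2 * (p + 1) / (p * q - 1)) * z₀ + 2) :
    ¬ ∃ u v : Euc N → ℝ, ContDiff ℝ 2 u ∧ ContDiff ℝ 2 v ∧
        (∀ x, 0 < u x) ∧ (∀ x, 0 < v x) ∧ IsLESol p q u v ∧
        ∀ Ω : Set (Euc N), IsOpen Ω → Bornology.IsBounded Ω → LEStableOn p q u v Ω := by
  rintro ⟨u, v, hu, hv, hu0, hv0, ⟨e1, e2⟩, hst⟩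
  have hq0 : 0 < q := by linarith
  have hp0 : 0 < p := by linarith
  have h3 : p + q + 1 < 3 * (p * q) := by
    have := (div_lt_iff₀ (by linarith : 0 < 3 * q - 1)).1 hp'
    linarith
  have hpq : 1 < p * q := by
    by_contra! h
    nlinarith [sq_nonneg (p - q), mul_pos hp0 hq0]
  have hpq' : (p + 1) * (q + 1) < 4 * (p * q) := by linarith
  have h1 : ∀ x, -lap u x = v x ^ p := fun x => by
    rw [e1, abs_of_pos (hv0 x), ← Real.rpow_add_one (hv0 x).ne', sub_add_cancel]
  have h2 : ∀ x, -lap v x = u x ^ q := fun x => by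
    rw [e2, abs_of_pos (hu0 x), ← Real.rpow_add_one (hu0 x).ne', sub_add_cancel]
  obtain ⟨l, hl, hcomp⟩ := exists_comparison hq0 hqp hpq hu hv hu0 h1 h2
  set κ := q - (q + 1) / (p + 1) with hκ
  have hκ' : κ = (p * q - 1) / (p + 1) := by rw [hκ]; field_simp; ring
  have hκ0 : 0 < κ := by rw [hκ']; exact div_pos (by linarith) (by linarith)
  have hκq : κ < q := sub_lt_self q (by positivity)
  have huκ : Continuous fun x => u x ^ κ :=
    hu.continuous.rpow_const fun x => Or.inl (hu0 x).ne'
  have huκ0 : ∀ x, 0 < u x ^ κ := fun x => Real.rpow_pos_of_pos (hu0 x) κ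
  have hhardy : ∀ φ : Euc N → ℝ, ContDiff ℝ 1 φ → HasCompactSupport φ →
      ∫ x, u x ^ κ * φ x ^ 2 ≤ l * ∫ x, gradSq φ x := fun φ hφ hc =>
    integral_rpow_mul_sq_le hv hu0 hv0 h2 hl hcomp hφ hc
  rcases le_or_gt N 2 with hN2 | hN3
  · exact false_of_hardy_of_le_two hN2 huκ huκ0 hl hhardy
  have hz : ((N : ℝ) - 2) * κ / 4 < z₀ := by
    have h4 : 2 * (2 * (p + 1) / (p * q - 1)) * z₀ = 4 * z₀ / κ := by
      have : p * q - 1 ≠ 0 := by linarith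
      rw [hκ']; field_simp; ring
    have h5 : (N : ℝ) - 2 < 4 * z₀ / κ := by linarith
    rw [lt_div_iff₀ hκ0] at h5
    linarith
  obtain ⟨t, ht, htz⟩ := exists_between (max_lt (half_add_one_lt_root hp0 hq0 hpq' hmax) hz)
  obtain ⟨htq, htN⟩ := max_lt_iff.1 ht
  have hG := Gpoly_neg_of_lt_root hp0 hq0 hpq' hroot htq htz
  have hrt : t * (p + 1) / (q + 1) * (q + 1) = t * (p + 1) := by field_simp
  have htr : t ≤ t * (p + 1) / (q + 1) := by
    rw [le_div_iff₀ (by linarith)]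
    exact mul_le_mul_of_nonneg_left (by linarith) (by linarith)
  obtain ⟨C₁, hC₁, hen⟩ := exists_energy_le hp0 hq0 hu hv hu0 hv0 h1 h2 hl hcomp
    (fun φ hφ hc => sqrt_mul_integral_le_of_stable hp0 hq0 hu.continuous hv.continuous hu0 hv0
      isOpen_thickening (hst _ isOpen_thickening hc.isCompact.isBounded.thickening) hφ hc
      (self_subset_thickening one_pos _))
    (by linarith) (by linarith) hrt (by linarith) (sq_mul_sq_lt_of_Gpoly_neg hp0 hq0 hrt hG)
  obtain ⟨C₂, hC₂, hJ⟩ := exists_setIntegral_le huκ (fun x => (huκ0 x).le) hl hhardy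
  exact false_of_energy hN3 hκ0 (by linarith) (by linarith) (hu.of_le (by norm_num)) hu0 hC₁ hen
    hC₂ hJ
end
end

section
/- Let N be a positive integer, let Ω ⊆ ℝ^N be an open set, and let w ∈ C²(Ω) with w > 0 on Ω. Then for every twice continuously differentiable function φ with compact support contained in Ω: ∫_Ω (−Δw(x)/w(x)) φ(x)² dx ≤ ∫_Ω |∇φ(x)|² dx. -/
open MeasureTheory Metric Set

noncomputable section

/-- The `i`-th component of the vector field `(φ² / w) ∇w`. -/
def quotientField {N : ℕ} (w φ : Euc N → ℝ) (i : Fin N) (x : Euc N) : ℝ :=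
  φ x ^ 2 * ((w x)⁻¹ * fderiv ℝ w x (EuclideanSpace.single i 1))

theorem hasCompactSupport_quotientField {N : ℕ} {w φ : Euc N → ℝ} (hφc : HasCompactSupport φ)
    (i : Fin N) : HasCompactSupport (quotientField w φ i) :=
  hφc.mono fun x hx h => hx (by simp [quotientField, h])

theorem contDiff_quotientField {N : ℕ} {Ω : Set (Euc N)} (hΩ : IsOpen Ω) {w φ : Euc N → ℝ}
    (hw : ContDiffOn ℝ 2 w Ω) (hw₀ : ∀ x ∈ Ω, w x ≠ 0) (hφ : ContDiff ℝ 2 φ)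
    (hsupp : tsupport φ ⊆ Ω) (i : Fin N) : ContDiff ℝ 1 (quotientField w φ i) := by
  rw [contDiff_iff_contDiffAt]
  intro x
  by_cases hx : x ∈ Ω
  · have hwx : ContDiffAt ℝ 2 w x := hw.contDiffAt (hΩ.mem_nhds hx)
    have h12 : (1 : WithTop ℕ∞) ≤ 2 := by norm_num
    have hdw : ContDiffAt ℝ 1 (fderiv ℝ w) x := hwx.fderiv_right (by norm_num)
    exact ((hφ.contDiffAt.of_le h12).pow 2).mul
      (((hwx.of_le h12).inv (hw₀ x hx)).mul (hdw.clm_apply contDiffAt_const))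
  · have h : quotientField w φ i =ᶠ[nhds x] fun _ => 0 := by
      filter_upwards [notMem_tsupport_iff_eventuallyEq.1 fun h => hx (hsupp h)] with y hy
      simp [quotientField, hy]
    exact contDiffAt_const.congr_of_eventuallyEq h

theorem integrable_fderiv_apply {N : ℕ} {f : Euc N → ℝ} (hf : ContDiff ℝ 1 f)
    (hfc : HasCompactSupport f) (v : Euc N) : Integrable fun x => fderiv ℝ f x v :=
  Continuous.integrable_of_hasCompactSupport
    ((hf.continuous_fderiv one_ne_zero).clm_apply continuous_const) (hfc.fderiv_apply ℝ v)

/-- The integral of a directional derivative of a compactly supported `C¹` function vanishes. -/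
theorem integral_fderiv_apply_eq_zero {N : ℕ} {f : Euc N → ℝ} (hf : ContDiff ℝ 1 f)
    (hfc : HasCompactSupport f) (v : Euc N) : ∫ x, fderiv ℝ f x v = 0 := by
  have h := integral_mul_fderiv_eq_neg_fderiv_mul_of_integrable (𝕜 := ℝ) (μ := volume)
    (f := f) (g := fun _ => (1 : ℝ)) (v := v)
    (by simpa using integrable_fderiv_apply hf hfc v) (by simp)
    (by simpa using hf.continuous.integrable_of_hasCompactSupport hfc)
    (fun x _ => (hf.differentiable one_ne_zero) x) (by fun_prop)
  simpa using h

theorem norm_gradient_sq {N : ℕ} (φ : Euc N → ℝ) (x : Euc N) :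
    ‖gradient φ x‖ ^ 2 = ∑ i, fderiv ℝ φ x (EuclideanSpace.single i 1) ^ 2 := by
  rw [EuclideanSpace.real_norm_sq_eq]
  refine Finset.sum_congr rfl fun i _ => ?_
  have h : inner ℝ (gradient φ x) (EuclideanSpace.single i 1) =
      fderiv ℝ φ x (EuclideanSpace.single i 1) := by
    simp [gradient]
  rw [← h, EuclideanSpace.inner_single_right]
  simp

theorem fderiv_quotientField_apply {N : ℕ} {w φ : Euc N → ℝ} {x : Euc N}
    (hw : ContDiffAt ℝ 2 w x) (hw₀ : w x ≠ 0) (hφ : DifferentiableAt ℝ φ x) (i : Fin N) :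
    fderiv ℝ (quotientField w φ i) x (EuclideanSpace.single i 1) =
      φ x ^ 2 * (iteratedFDeriv ℝ 2 w x
        ![EuclideanSpace.single i 1, EuclideanSpace.single i 1] / w x) +
      2 * fderiv ℝ φ x (EuclideanSpace.single i 1) *
        (φ x * (fderiv ℝ w x (EuclideanSpace.single i 1) / w x)) -
      (φ x * (fderiv ℝ w x (EuclideanSpace.single i 1) / w x)) ^ 2 := by
  have hdw : DifferentiableAt ℝ (fderiv ℝ w) x :=
    (hw.fderiv_right (m := 1) (by norm_num)).differentiableAt one_ne_zero
  have hw' : HasFDerivAt w (fderiv ℝ w x) x := (hw.differentiableAt two_ne_zero).hasFDerivAt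
  have h : HasFDerivAt (quotientField w φ i) _ x :=
    (hφ.hasFDerivAt.pow 2).mul (((hasDerivAt_inv hw₀).comp_hasFDerivAt x hw').mul
      (hdw.hasFDerivAt.clm_apply (hasFDerivAt_const (EuclideanSpace.single i (1 : ℝ)) x)))
  rw [h.fderiv, iteratedFDeriv_two_apply]
  simp
  field_simp
  ring

theorem neg_lap_div_mul_sq_le {N : ℕ} {w φ : Euc N → ℝ} {x : Euc N}
    (hw : ContDiffAt ℝ 2 w x) (hw₀ : w x ≠ 0) (hφ : DifferentiableAt ℝ φ x) :
    (-lap w x / w x) * φ x ^ 2 ≤ ‖gradient φ x‖ ^ 2 -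
      ∑ i, fderiv ℝ (quotientField w φ i) x (EuclideanSpace.single i 1) := by
  rw [norm_gradient_sq, ← Finset.sum_sub_distrib, lap, ← Finset.sum_neg_distrib, Finset.sum_div,
    Finset.sum_mul]
  refine Finset.sum_le_sum fun i _ => ?_
  rw [fderiv_quotientField_apply hw hw₀ hφ, neg_div]
  nlinarith [sq_nonneg (fderiv ℝ φ x (EuclideanSpace.single i 1) -
    φ x * (fderiv ℝ w x (EuclideanSpace.single i 1) / w x))]

/-- Lemma 3.1: for a positive `C²` function `w` on an open set `Ω`,
`∫ (-Δw/w) φ² ≤ ∫ |∇φ|²` for every `φ ∈ C_c²(Ω)`. -/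
theorem stmt_14 (N : ℕ) (hN : 0 < N) (Ω : Set (Euc N)) (hΩ : IsOpen Ω)
    (w : Euc N → ℝ) (hw : ContDiffOn ℝ 2 w Ω) (hwpos : ∀ x ∈ Ω, 0 < w x)
    (φ : Euc N → ℝ) (hφ : ContDiff ℝ 2 φ) (hφc : HasCompactSupport φ)
    (hsupp : tsupport φ ⊆ Ω) :
    (∫ x in Ω, (-lap w x / w x) * φ x ^ 2) ≤ ∫ x in Ω, ‖gradient φ x‖ ^ 2 := by
  have hw₀ : ∀ x ∈ Ω, w x ≠ 0 := fun x hx => (hwpos x hx).ne'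
  have hF (i : Fin N) := contDiff_quotientField hΩ hw hw₀ hφ hsupp i
  have hFc (i : Fin N) := hasCompactSupport_quotientField (w := w) hφc i
  have hFint (i : Fin N) : Integrable fun x =>
      fderiv ℝ (quotientField w φ i) x (EuclideanSpace.single i 1) :=
    integrable_fderiv_apply (hF i) (hFc i) _
  have hFzero (i : Fin N) :
      ∫ x in Ω, fderiv ℝ (quotientField w φ i) x (EuclideanSpace.single i 1) = 0 := by
    rw [setIntegral_eq_integral_of_forall_compl_eq_zero,
      integral_fderiv_apply_eq_zero (hF i) (hFc i)]
    intro x hx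
    have hsub : tsupport (quotientField w φ i) ⊆ tsupport φ :=
      closure_mono fun y hy h => hy (by simp [quotientField, h])
    rw [fderiv_of_notMem_tsupport ℝ fun h => hx (hsupp (hsub h)), zero_apply]
  have hdφ : Continuous fun x => ∑ i, fderiv ℝ φ x (EuclideanSpace.single i 1) ^ 2 :=
    continuous_finsetSum _ fun i _ =>
      ((hφ.continuous_fderiv two_ne_zero).clm_apply continuous_const).pow 2
  have hGint : Integrable fun x => ‖gradient φ x‖ ^ 2 := by
    simp_rw [norm_gradient_sq]
    refine hdφ.integrable_of_hasCompactSupport ((hφc.fderiv ℝ).mono fun x hx h => hx ?_)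
    simp [h]
  by_cases hint : IntegrableOn (fun x => (-lap w x / w x) * φ x ^ 2) Ω
  · calc ∫ x in Ω, (-lap w x / w x) * φ x ^ 2
        ≤ ∫ x in Ω, (‖gradient φ x‖ ^ 2 -
            ∑ i, fderiv ℝ (quotientField w φ i) x (EuclideanSpace.single i 1)) :=
          setIntegral_mono_on hint
            (hGint.sub (integrable_finsetSum _ fun i _ => hFint i)).integrableOn
            hΩ.measurableSet fun x hx => neg_lap_div_mul_sq_le
              (hw.contDiffAt (hΩ.mem_nhds hx)) (hw₀ x hx) (hφ.differentiable two_ne_zero x)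
      _ = ∫ x in Ω, ‖gradient φ x‖ ^ 2 := by
          rw [integral_sub hGint.integrableOn
              (integrable_finsetSum _ fun i _ => (hFint i).integrableOn),
            integral_finsetSum _ fun i _ => (hFint i).integrableOn]
          simp [hFzero]
  · rw [integral_undef hint]
    exact integral_nonneg fun x => sq_nonneg _
end
end

section
/- Let N ≥ 2, let p ≥ q > 0 with pq > 1, let a, b > −2, and assume 0 ≤ a − b ≤ (N−2)(p−q). Then every positive solution (u,v) of the Hénon–Lane–Emden system (HLE) satisfies |x|^a v(x)^{p+1} ≤ ((p+1)/(q+1)) |x|^b u(x)^{q+1} for every x ∈ ℝ^N ∖ {0}. -/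
open MeasureTheory Metric Set

noncomputable section

/-- `f` is differentiable near `0` and twice differentiable at `0`, with first and second
derivatives `f₁` and `f₂` at `0`. -/
def HasTwoDerivs (f : ℝ → ℝ) (f₁ f₂ : ℝ) : Prop :=
  ∃ g : ℝ → ℝ, (∀ᶠ t in nhds 0, HasDerivAt f (g t) t) ∧ g 0 = f₁ ∧ HasDerivAt g f₂ 0

namespace HasTwoDerivs

variable {f g : ℝ → ℝ} {f₁ f₂ g₁ g₂ : ℝ}

lemma add (hf : HasTwoDerivs f f₁ f₂) (hg : HasTwoDerivs g g₁ g₂) :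
    HasTwoDerivs (fun t => f t + g t) (f₁ + g₁) (f₂ + g₂) := by
  obtain ⟨f', h1, h2, h3⟩ := hf
  obtain ⟨g', k1, k2, k3⟩ := hg
  refine ⟨fun t => f' t + g' t, ?_, by simp [h2, k2], h3.add k3⟩
  filter_upwards [h1, k1] with t ht kt using ht.add kt

lemma sub (hf : HasTwoDerivs f f₁ f₂) (hg : HasTwoDerivs g g₁ g₂) :
    HasTwoDerivs (fun t => f t - g t) (f₁ - g₁) (f₂ - g₂) := by
  obtain ⟨f', h1, h2, h3⟩ := hf
  obtain ⟨g', k1, k2, k3⟩ := hg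
  refine ⟨fun t => f' t - g' t, ?_, by simp [h2, k2], h3.sub k3⟩
  filter_upwards [h1, k1] with t ht kt using ht.sub kt

lemma const_mul (c : ℝ) (hf : HasTwoDerivs f f₁ f₂) :
    HasTwoDerivs (fun t => c * f t) (c * f₁) (c * f₂) := by
  obtain ⟨f', h1, h2, h3⟩ := hf
  refine ⟨fun t => c * f' t, ?_, by simp [h2], h3.const_mul c⟩
  filter_upwards [h1] with t ht using ht.const_mul c

lemma const_add (c : ℝ) (hf : HasTwoDerivs f f₁ f₂) :
    HasTwoDerivs (fun t => c + f t) f₁ f₂ := by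
  obtain ⟨f', h1, h2, h3⟩ := hf
  refine ⟨f', ?_, h2, h3⟩
  filter_upwards [h1] with t ht using ht.const_add c

lemma comp {G G' : ℝ → ℝ} {c : ℝ} (hf : HasTwoDerivs f f₁ f₂)
    (hG : ∀ᶠ s in nhds (f 0), HasDerivAt G (G' s) s) (hG' : HasDerivAt G' c (f 0)) :
    HasTwoDerivs (fun t => G (f t)) (G' (f 0) * f₁) (c * f₁ ^ 2 + G' (f 0) * f₂) := by
  obtain ⟨f', h1, h2, h3⟩ := hf
  have h0 : HasDerivAt f (f' 0) 0 := h1.self_of_nhds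
  refine ⟨fun t => G' (f t) * f' t, ?_, by simp [h2], ?_⟩
  · filter_upwards [h1, h0.continuousAt.eventually hG] with t ht kt using kt.comp t ht
  · refine ((hG'.comp (0 : ℝ) h0).mul h3).congr_deriv ?_
    simp only [Function.comp_apply, h2]
    ring

lemma exp (hf : HasTwoDerivs f f₁ f₂) :
    HasTwoDerivs (fun t => Real.exp (f t)) (Real.exp (f 0) * f₁)
      (Real.exp (f 0) * (f₂ + f₁ ^ 2)) := by
  have := hf.comp (G := Real.exp) (G' := Real.exp) (c := Real.exp (f 0))
    (Filter.Eventually.of_forall Real.hasDerivAt_exp) (Real.hasDerivAt_exp _)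
  convert this using 1
  ring

lemma log (hf : HasTwoDerivs f f₁ f₂) (h0 : f 0 ≠ 0) :
    HasTwoDerivs (fun t => Real.log (f t)) (f₁ / f 0) (f₂ / f 0 - f₁ ^ 2 / f 0 ^ 2) := by
  have := hf.comp (G := Real.log) (G' := fun s => s⁻¹) (c := -(f 0 ^ 2)⁻¹)
    (by filter_upwards [isOpen_ne.mem_nhds h0] with s hs using Real.hasDerivAt_log hs)
    (hasDerivAt_inv h0)
  convert this using 1
  · ring
  · ring

/-- Second-order necessary condition at a local maximum. -/
lemma nonpos_of_isLocalMax (hf : HasTwoDerivs f f₁ f₂) (hmax : IsLocalMax f 0) : f₂ ≤ 0 := by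
  obtain ⟨f', h1, h2, h3⟩ := hf
  by_contra! hpos
  have hd : deriv f =ᶠ[nhds 0] f' := by
    filter_upwards [h1] with t ht using ht.deriv
  have hdd : HasDerivAt (deriv f) f₂ 0 := h3.congr_of_eventuallyEq hd
  have hmin : IsLocalMin f 0 := isLocalMin_of_deriv_deriv_pos (by rw [hdd.deriv]; exact hpos)
    hmax.deriv_eq_zero h1.self_of_nhds.continuousAt
  have hconst : f =ᶠ[nhds 0] fun _ => f 0 := by
    filter_upwards [hmax, hmin] with t ht kt using le_antisymm ht kt
  have hd0 : deriv f =ᶠ[nhds 0] fun _ => 0 := by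
    filter_upwards [hconst.eventuallyEq_nhds] with t ht
    rw [ht.deriv_eq]; simp
  have := hd0.deriv_eq
  rw [hdd.deriv] at this
  simp at this
  linarith

end HasTwoDerivs

/-- Restricting a `C²` function to a line gives its pure second derivative. -/
lemma hasTwoDerivs_line {N : ℕ} {f : Euc N → ℝ} (hf : ContDiffOn ℝ 2 f {x : Euc N | x ≠ 0})
    {x : Euc N} (hx : x ≠ 0) (e : Euc N) :
    HasTwoDerivs (fun t : ℝ => f (x + t • e)) (fderiv ℝ f x e)
      (iteratedFDeriv ℝ 2 f x ![e, e]) := by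
  have hopen : IsOpen {x : Euc N | x ≠ 0} := isOpen_ne
  have hline : ∀ t : ℝ, HasDerivAt (fun t : ℝ => x + t • e) e t := fun t => by
    simpa using ((hasDerivAt_id t).smul_const e).const_add x
  have hat : ContDiffAt ℝ 2 f x := hf.contDiffAt (hopen.mem_nhds hx)
  refine ⟨fun t => fderiv ℝ f (x + t • e) e, ?_, by simp, ?_⟩
  · have hc : ContinuousAt (fun t : ℝ => x + t • e) 0 := (hline 0).continuousAt
    have : ∀ᶠ t : ℝ in nhds 0, x + t • e ≠ 0 :=
      hc.eventually (hopen.mem_nhds (by simpa using hx))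
    filter_upwards [this] with t ht
    have hd : DifferentiableAt ℝ f (x + t • e) :=
      (hf.contDiffAt (hopen.mem_nhds ht)).differentiableAt (by norm_num)
    exact hd.hasFDerivAt.comp_hasDerivAt t (hline t)
  · have hd : DifferentiableAt ℝ (fderiv ℝ f) x :=
      (hat.fderiv_right (m := 1) (by norm_num)).differentiableAt (by norm_num)
    have hd' : HasFDerivAt (fderiv ℝ f) (fderiv ℝ (fderiv ℝ f) x) (x + (0 : ℝ) • e) := by
      simpa using hd.hasFDerivAt
    have h1 := hd'.comp_hasDerivAt (0 : ℝ) (hline 0)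
    have h2 := h1.clm_apply (hasDerivAt_const (0 : ℝ) e)
    rw [iteratedFDeriv_two_apply]
    simpa using h2

/-- The squared norm along a coordinate line. -/
lemma hasTwoDerivs_normSq_line {N : ℕ} (x : Euc N) (i : Fin N) :
    HasTwoDerivs (fun t : ℝ => ‖x + t • EuclideanSpace.single i (1 : ℝ)‖ ^ 2) (2 * x i) 2 := by
  have hP : (fun t : ℝ => ‖x + t • EuclideanSpace.single i (1 : ℝ)‖ ^ 2) =
      fun t => ‖x‖ ^ 2 + (2 * x i) * t + t ^ 2 := by
    funext t
    rw [norm_add_sq_real, norm_smul, inner_smul_right, EuclideanSpace.inner_single_right]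
    simp
    ring
  rw [hP]
  refine ⟨fun t => 2 * x i + 2 * t, Filter.Eventually.of_forall fun t => ?_, by simp, ?_⟩
  · refine ((((hasDerivAt_id t).const_mul (2 * x i)).const_add (‖x‖ ^ 2)).add
      ((hasDerivAt_id t).pow 2)).congr_deriv ?_
    simp
  · simpa using ((hasDerivAt_id (0 : ℝ)).const_mul 2).const_add (2 * x i)

/-- The radial barrier, as a function of the squared norm. -/
def barrier (A T k M δ S : ℝ) : ℝ :=
  A * (T - S ^ (M / 2)) ^ (-k) + δ * (Real.log T - M / 2 * Real.log S)

/-- First derivative of `barrier`. -/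
def barrierDeriv (A T k M δ S : ℝ) : ℝ :=
  A * (k * (T - S ^ (M / 2)) ^ (-k - 1) * (M / 2 * S ^ (M / 2 - 1))) - δ * (M / 2) * S⁻¹

/-- Second derivative of `barrier`. -/
def barrierDeriv₂ (A T k M δ S : ℝ) : ℝ :=
  A * (k * ((k + 1) * (T - S ^ (M / 2)) ^ (-k - 2) * (M / 2 * S ^ (M / 2 - 1)) ^ 2 +
    (T - S ^ (M / 2)) ^ (-k - 1) * (M / 2 * (M / 2 - 1) * S ^ (M / 2 - 2)))) +
    δ * (M / 2) * (S ^ 2)⁻¹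

lemma hasDerivAt_barrier {A T k M δ S : ℝ} (hS : 0 < S) (hT : S ^ (M / 2) < T) :
    HasDerivAt (barrier A T k M δ) (barrierDeriv A T k M δ S) S := by
  have h1 : HasDerivAt (fun S : ℝ => T - S ^ (M / 2)) (-(M / 2 * S ^ (M / 2 - 1))) S :=
    (Real.hasDerivAt_rpow_const (Or.inl hS.ne')).const_sub T
  have h2 := (h1.rpow_const (p := -k) (Or.inl (sub_pos.2 hT).ne')).const_mul A
  have h3 := (((Real.hasDerivAt_log hS.ne').const_mul (M / 2)).const_sub (Real.log T)).const_mul δ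
  refine (h2.add h3).congr_deriv ?_
  unfold barrierDeriv
  ring

lemma hasDerivAt_barrierDeriv {A T k M δ S : ℝ} (hS : 0 < S) (hT : S ^ (M / 2) < T) :
    HasDerivAt (barrierDeriv A T k M δ) (barrierDeriv₂ A T k M δ S) S := by
  have h1 : HasDerivAt (fun S : ℝ => T - S ^ (M / 2)) (-(M / 2 * S ^ (M / 2 - 1))) S :=
    (Real.hasDerivAt_rpow_const (Or.inl hS.ne')).const_sub T
  have h2 := (h1.rpow_const (p := -k - 1) (Or.inl (sub_pos.2 hT).ne')).const_mul k
  have h4 : HasDerivAt (fun S : ℝ => M / 2 * S ^ (M / 2 - 1))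
      (M / 2 * ((M / 2 - 1) * S ^ (M / 2 - 1 - 1))) S :=
    (Real.hasDerivAt_rpow_const (Or.inl hS.ne')).const_mul (M / 2)
  have h3 := (hasDerivAt_inv hS.ne').const_mul (δ * (M / 2))
  refine (((h2.mul h4).const_mul A).sub h3).congr_deriv ?_
  have e1 : M / 2 - 1 - 1 = M / 2 - 2 := by ring
  have e2 : -k - 1 - 1 = -k - 2 := by ring
  unfold barrierDeriv₂
  rw [e1, e2]
  ring

/-- The Laplacian of the barrier is controlled by a power of its singular part. -/
lemma barrier_laplacian_le {n A T k M δ S : ℝ} (hn : 2 ≤ n) (hA : 0 < A) (hk : 0 < k)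
    (hM : 0 < M) (hδ : 0 < δ) (hS : 0 < S) (hT : S ^ (M / 2) < T) :
    4 * S * barrierDeriv₂ A T k M δ S + 2 * n * barrierDeriv A T k M δ S ≤
      S ^ (M / 2 - 1) * ((k * (M ^ 2 * (k + 1) + M * (M + n - 2)) * T) *
        (A * (T - S ^ (M / 2)) ^ (-k - 2))) := by
  set t := S ^ (M / 2) with ht
  set B := S ^ (M / 2 - 1) with hB
  set E := (T - t) ^ (-k - 2) with hE
  have htp : 0 < t := Real.rpow_pos_of_pos hS _
  have hBp : 0 < B := Real.rpow_pos_of_pos hS _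
  have hd : 0 < T - t := sub_pos.2 hT
  have hEp : 0 < E := Real.rpow_pos_of_pos hd _
  have hE1 : (T - t) ^ (-k - 1) = E * (T - t) := by
    rw [hE, ← Real.rpow_add_one hd.ne']; congr 1; ring
  have hB1 : S ^ (M / 2 - 2) * S = B := by
    rw [hB, ← Real.rpow_add_one hS.ne']; congr 1; ring
  have hB2 : B * S = t := by
    rw [hB, ← Real.rpow_add_one hS.ne']; congr 1; ring
  have hlog : 4 * S * (δ * (M / 2) * (S ^ 2)⁻¹) - 2 * n * (δ * (M / 2) * S⁻¹) =
      -((n - 2) * δ * M * S⁻¹) := by field_simp; ring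
  have hlogn : 0 ≤ (n - 2) * δ * M * S⁻¹ := by
    have : 0 ≤ n - 2 := by linarith
    positivity
  have hmain : 4 * S * barrierDeriv₂ A T k M δ S + 2 * n * barrierDeriv A T k M δ S =
      B * A * k * E * (M ^ 2 * (k + 1) * t + M * (M + n - 2) * (T - t)) -
        (n - 2) * δ * M * S⁻¹ := by
    unfold barrierDeriv₂ barrierDeriv
    rw [← ht, ← hB, ← hE, hE1]
    linear_combination hlog + 4 * A * k * (E * (T - t)) * (M / 2 * (M / 2 - 1)) * hB1 +
      A * k * (k + 1) * E * M ^ 2 * B * hB2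
  have hle : M ^ 2 * (k + 1) * t + M * (M + n - 2) * (T - t) ≤
      (M ^ 2 * (k + 1) + M * (M + n - 2)) * T := by
    have h1 : 0 ≤ M ^ 2 * (k + 1) * (T - t) := by positivity
    have h2 : 0 ≤ M * (M + n - 2) * t := by
      have : 0 ≤ M + n - 2 := by linarith
      positivity
    linarith
  have := mul_le_mul_of_nonneg_left hle (by positivity : 0 ≤ B * A * k * E)
  rw [hmain]
  linarith

/-- The bound for one coordinate of the Laplacian of `|x|^κ u^σ`, with `κ = -(1 - σ) μ`. -/
lemma power_product_second_deriv_le {S u x U₁ U₂ σ μ κ : ℝ} (hS : 0 < S) (hu : 0 < u)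
    (hσ : 0 ≤ σ) (hσ1 : σ ≤ 1) (hκ : κ = -((1 - σ) * μ)) :
    (κ / 2 * (2 / S - (2 * x) ^ 2 / S ^ 2) + σ * (U₂ / u - U₁ ^ 2 / u ^ 2)) +
      (κ / 2 * ((2 * x) / S) + σ * (U₁ / u)) ^ 2 ≤
    κ / S + σ / u * U₂ + ((1 - σ) * μ ^ 2 - 2 * κ) / S ^ 2 * x ^ 2 := by
  have h : 0 ≤ (1 - σ) * σ * (U₁ / u + μ * x / S) ^ 2 := by
    have : 0 ≤ 1 - σ := by linarith
    positivity
  subst hκ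
  rw [← sub_nonneg]
  convert h using 1
  field_simp
  ring

/-- The nonlinear terms dominate `f ^ (1 + e)` wherever `v` exceeds `z` by more than `f`. -/
lemma nonlinearity_lower_bound {p q a b r u v z f σ κ lam : ℝ} (hq : 0 < q) (hqp : q ≤ p)
    (hpq : 1 < p * q) (hr : 0 < r) (hu : 0 < u) (hf : 0 < f)
    (hσ : σ = (q + 1) / (p + 1)) (hκ : κ = (b - a) / (p + 1))
    (hlam : lam = -Real.log σ / (p + 1))
    (hz : z = Real.exp (lam + (κ / 2 * Real.log (r ^ 2) + σ * Real.log u)))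
    (hv : z + f < v) :
    σ * Real.exp (lam / σ) * r ^ (κ / σ + a) * f ^ (1 + (p - 1 / σ)) <
      z * (σ / u * (r ^ a * v ^ p)) - r ^ b * u ^ q := by
  have hp : 0 < p := lt_of_lt_of_le hq hqp
  have hp1 : 1 ≤ p := by nlinarith
  have hσp : 0 < σ := by rw [hσ]; positivity
  have hzp : 0 < z := by rw [hz]; exact Real.exp_pos _
  have hvp : 0 < v := by linarith
  have hlz : Real.log z = lam + (κ * Real.log r + σ * Real.log u) := by
    rw [hz, Real.log_exp, Real.log_pow]; push_cast; ring
  have hzE : z = Real.exp (Real.log z) := (Real.exp_log hzp).symm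
  have huE : u = Real.exp (Real.log u) := (Real.exp_log hu).symm
  have hσE : σ = Real.exp (Real.log σ) := (Real.exp_log hσp).symm
  have hlσ : Real.log σ = -(lam * (p + 1)) := by rw [hlam]; field_simp
  have hκ' : κ * (p + 1) = b - a := by rw [hκ]; field_simp
  have hσ' : σ * (p + 1) = q + 1 := by rw [hσ]; field_simp
  have h1 : r ^ b * u ^ q = z * (σ / u * (r ^ a * z ^ p)) := by
    have : z * (σ / u * (r ^ a * z ^ p)) = Real.exp (Real.log z + (Real.log σ - Real.log u +
        (Real.log r * a + Real.log z * p))) := by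
      rw [Real.exp_add, Real.exp_add, Real.exp_sub, Real.exp_add, Real.exp_log hzp,
        Real.exp_log hσp, Real.exp_log hu, Real.rpow_def_of_pos hr, Real.rpow_def_of_pos hzp]
    rw [this, Real.rpow_def_of_pos hr, Real.rpow_def_of_pos hu, ← Real.exp_add]
    congr 1
    rw [hlz, hlσ]
    linear_combination (-Real.log r) * hκ' - Real.log u * hσ'
  have h2 : z / u = Real.exp (lam / σ) * r ^ (κ / σ) * z ^ (1 - 1 / σ) := by
    have : z / u = Real.exp (Real.log z - Real.log u) := by
      rw [Real.exp_sub, Real.exp_log hzp, Real.exp_log hu]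
    rw [this, Real.rpow_def_of_pos hr, Real.rpow_def_of_pos hzp, ← Real.exp_add, ← Real.exp_add]
    congr 1
    have : Real.log u = (Real.log z - lam - κ * Real.log r) / σ := by
      rw [hlz]; field_simp; ring
    rw [this]; field_simp; ring
  have hσ1 : σ ≤ 1 := by rw [hσ, div_le_one (by linarith)]; linarith
  have hinv : 1 / σ = (p + 1) / (q + 1) := by rw [hσ]; field_simp
  have hexp : 0 < p - 1 / σ := by
    rw [hinv, sub_pos, div_lt_iff₀ (by linarith)]; nlinarith
  have hexp2 : 1 - 1 / σ ≤ 0 := by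
    have : 1 ≤ 1 / σ := by rw [le_div_iff₀ hσp]; linarith
    linarith
  have h3 : v ^ (p - 1) * f < v ^ p - z ^ p := by
    have e1 : v ^ p = v ^ (p - 1) * v := by
      rw [← Real.rpow_add_one hvp.ne']; congr 1; ring
    have e2 : z ^ p = z ^ (p - 1) * z := by
      rw [← Real.rpow_add_one hzp.ne']; congr 1; ring
    have e3 : z ^ (p - 1) ≤ v ^ (p - 1) :=
      Real.rpow_le_rpow hzp.le (by linarith) (by linarith)
    have e4 : 0 < v ^ (p - 1) := Real.rpow_pos_of_pos hvp _
    rw [e1, e2]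
    nlinarith [mul_le_mul_of_nonneg_right e3 hzp.le]
  have h4 : v ^ (1 - 1 / σ) ≤ z ^ (1 - 1 / σ) :=
    Real.rpow_le_rpow_of_nonpos hzp (by linarith) hexp2
  have h5 : f ^ (p - 1 / σ) ≤ v ^ (1 - 1 / σ) * v ^ (p - 1) := by
    rw [← Real.rpow_add hvp, show 1 - 1 / σ + (p - 1) = p - 1 / σ by ring]
    exact Real.rpow_le_rpow hf.le (by linarith) hexp.le
  have h6 : f ^ (1 + (p - 1 / σ)) < z ^ (1 - 1 / σ) * (v ^ p - z ^ p) := by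
    calc f ^ (1 + (p - 1 / σ)) = f ^ (p - 1 / σ) * f := by
          rw [← Real.rpow_add_one hf.ne', add_comm]
      _ ≤ v ^ (1 - 1 / σ) * v ^ (p - 1) * f := mul_le_mul_of_nonneg_right h5 hf.le
      _ = v ^ (1 - 1 / σ) * (v ^ (p - 1) * f) := by ring
      _ < v ^ (1 - 1 / σ) * (v ^ p - z ^ p) :=
          mul_lt_mul_of_pos_left h3 (Real.rpow_pos_of_pos hvp _)
      _ ≤ z ^ (1 - 1 / σ) * (v ^ p - z ^ p) := by
          refine mul_le_mul_of_nonneg_right h4 ?_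
          have : 0 < v ^ (p - 1) * f := mul_pos (Real.rpow_pos_of_pos hvp _) hf
          linarith
  have hpos : 0 < σ * Real.exp (lam / σ) * r ^ (κ / σ + a) := by positivity
  calc _ < σ * Real.exp (lam / σ) * r ^ (κ / σ + a) * (z ^ (1 - 1 / σ) * (v ^ p - z ^ p)) :=
        mul_lt_mul_of_pos_left h6 hpos
    _ = z * (σ / u * (r ^ a * v ^ p)) - r ^ b * u ^ q := by
        rw [h1, Real.rpow_add hr]
        linear_combination (-(σ * r ^ a * (v ^ p - z ^ p))) * h2

/-- Parameters for which the barrier is smaller than `w` at a given radius. -/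
lemma exists_barrier_params {t w K e : ℝ} (ht : 0 < t) (hw : 0 < w) (hK : 0 < K) (he : 0 < e) :
    ∃ T A δ : ℝ, t < T ∧ 0 < A ∧ 0 < δ ∧ A ^ e = K * T ∧
      A * (T - t) ^ (-(2 / e)) + δ * (Real.log T - Real.log t) < w := by
  have hwe : 0 < w ^ e := Real.rpow_pos_of_pos hw e
  obtain ⟨T, hT⟩ : ∃ T, T = 2 * t + 4 * K / w ^ e + 1 := ⟨_, rfl⟩
  have hq : 0 < 4 * K / w ^ e := by positivity
  have htT : 2 * t < T := by linarith
  have hTp : 0 < T := by linarith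
  have hd : 0 < T - t := by linarith
  have hKT : 4 * K < w ^ e * T := by
    have : 4 * K / w ^ e < T := by linarith
    rw [div_lt_iff₀ hwe] at this
    linarith
  have hAe : ((K * T) ^ (1 / e)) ^ e = K * T := by
    rw [← Real.rpow_mul (by positivity), one_div_mul_cancel he.ne', Real.rpow_one]
  have hA : 0 < (K * T) ^ (1 / e) := by positivity
  have hmain : (K * T) ^ (1 / e) * (T - t) ^ (-(2 / e)) < w := by
    rw [← Real.rpow_lt_rpow_iff (by positivity) hw.le he, Real.mul_rpow hA.le (by positivity), hAe,
      ← Real.rpow_mul hd.le, show -(2 / e) * e = -(2 : ℝ) by field_simp, Real.rpow_neg hd.le,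
      Real.rpow_two, ← div_eq_mul_inv, div_lt_iff₀ (by positivity)]
    have h1 : T ^ 2 / 4 ≤ (T - t) ^ 2 := by nlinarith
    nlinarith [mul_lt_mul_of_pos_right hKT hTp, mul_le_mul_of_nonneg_left h1 hwe.le]
  have hlog : 0 < Real.log T - Real.log t := sub_pos.2 (Real.log_lt_log ht (by linarith))
  refine ⟨T, _, (w - (K * T) ^ (1 / e) * (T - t) ^ (-(2 / e))) /
    (2 * (Real.log T - Real.log t)), by linarith, hA, ?_, hAe, ?_⟩
  · exact div_pos (sub_pos.2 hmain) (by positivity)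
  · rw [div_mul_eq_mul_div, mul_div_mul_right _ _ hlog.ne']
    linarith

/-- If `v - Z` exceeds the barrier somewhere, the difference has an interior local maximum. -/
lemma exists_isLocalMax_sub_barrier {N : ℕ} {v Z : Euc N → ℝ} {A T k M δ : ℝ}
    (hv : Continuous v) (hZ : ContinuousOn Z {x : Euc N | x ≠ 0}) (hZ0 : ∀ x, 0 < Z x)
    (hA : 0 < A) (hk : 0 < k) (hM : 0 < M) (hδ : 0 < δ) {x : Euc N} (hx : x ≠ 0)
    (hxT : (‖x‖ ^ 2) ^ (M / 2) < T)
    (hpos : 0 < v x - (Z x + barrier A T k M δ (‖x‖ ^ 2))) :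
    ∃ y : Euc N, y ≠ 0 ∧ (‖y‖ ^ 2) ^ (M / 2) < T ∧
      0 < v y - (Z y + barrier A T k M δ (‖y‖ ^ 2)) ∧
      IsLocalMax (fun y => v y - (Z y + barrier A T k M δ (‖y‖ ^ 2))) y := by
  set τ : Euc N → ℝ := fun y => (‖y‖ ^ 2) ^ (M / 2) with hτ
  have hτc : Continuous τ :=
    (continuous_norm.pow 2).rpow_const fun y => Or.inr (by positivity)
  have hτ0 : ∀ y : Euc N, y ≠ 0 → 0 < τ y := fun y hy => by
    have : 0 < ‖y‖ := norm_pos_iff.2 hy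
    exact Real.rpow_pos_of_pos (by positivity) _
  have hτ0' : τ 0 = 0 := by
    simp [hτ, Real.zero_rpow (by positivity : M / 2 ≠ 0)]
  have hTp : 0 < T := (hτ0 x hx).trans hxT
  have hcpt : IsCompact {y : Euc N | τ y ≤ T} := by
    refine Metric.isCompact_of_isClosed_isBounded (isClosed_le hτc continuous_const) ?_
    refine (Metric.isBounded_closedBall (x := (0 : Euc N)) (r := T ^ (1 / M))).subset ?_
    intro y hy
    rw [mem_closedBall_zero_iff]
    have h1 : τ y = ‖y‖ ^ M := by
      rw [hτ]
      dsimp only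
      rw [← Real.rpow_natCast, ← Real.rpow_mul (norm_nonneg y)]
      congr 1
      push_cast
      ring
    have h2 : ‖y‖ = (τ y) ^ (1 / M) := by
      rw [h1, ← Real.rpow_mul (norm_nonneg y), mul_one_div_cancel hM.ne', Real.rpow_one]
    rw [h2]
    exact Real.rpow_le_rpow (by rw [h1]; positivity) hy (by positivity)
  obtain ⟨V₀, hV₀⟩ := hcpt.exists_bound_of_continuousOn hv.continuousOn
  obtain ⟨V, hV, hVp⟩ : ∃ V, V₀ ≤ V ∧ 0 < V := ⟨max V₀ 1, le_max_left _ _, by positivity⟩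
  set D : Euc N → ℝ := fun y => v y - (Z y + barrier A T k M δ (‖y‖ ^ 2)) with hD
  set K : Set (Euc N) := {y | T * Real.exp (-(V / δ)) ≤ τ y ∧ τ y ≤ T - (A / V) ^ (1 / k)} with hKdef
  have hgap : 0 < (A / V) ^ (1 / k) := by positivity
  have hKcpt : IsCompact K := by
    refine hcpt.of_isClosed_subset ((isClosed_le continuous_const hτc).inter
      (isClosed_le hτc continuous_const)) fun y hy => ?_
    have := hy.2
    simp only [Set.mem_ofPred_eq]
    linarith
  have hKne : ∀ y ∈ K, y ≠ 0 := by
    rintro y hy rfl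
    have h1 := hy.1
    rw [hτ0'] at h1
    have : 0 < T * Real.exp (-(V / δ)) := by positivity
    linarith
  have hmem : ∀ y : Euc N, y ≠ 0 → τ y < T → 0 < D y → y ∈ K := by
    intro y hy hyT hDy
    have hτy := hτ0 y hy
    have hny : 0 < ‖y‖ := norm_pos_iff.2 hy
    have hvV : v y ≤ V := ((le_abs_self _).trans (hV₀ y hyT.le)).trans hV
    have hlog : M / 2 * Real.log (‖y‖ ^ 2) = Real.log (τ y) :=
      (Real.log_rpow (by positivity) _).symm
    have hdy : 0 < T - τ y := sub_pos.2 hyT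
    have hlt : A * (T - τ y) ^ (-k) + δ * (Real.log T - Real.log (τ y)) < V := by
      have h0 : 0 < v y - (Z y + barrier A T k M δ (‖y‖ ^ 2)) := hDy
      unfold barrier at h0
      rw [hlog] at h0
      have := hZ0 y
      change 0 < v y - (Z y + (A * (T - τ y) ^ (-k) + δ * (Real.log T - Real.log (τ y)))) at h0
      linarith
    have hL : 0 < δ * (Real.log T - Real.log (τ y)) :=
      mul_pos hδ (sub_pos.2 (Real.log_lt_log hτy hyT))
    have hB : 0 < A * (T - τ y) ^ (-k) := by positivity
    constructor
    · have h1 : δ * (Real.log T - Real.log (τ y)) < V := by linarith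
      have h2 : Real.log T - Real.log (τ y) < V / δ := by rwa [lt_div_iff₀ hδ, mul_comm]
      have h3 : Real.log T + -(V / δ) ≤ Real.log (τ y) := by linarith
      have h4 := Real.exp_le_exp.2 h3
      rwa [Real.exp_add, Real.exp_log hTp, Real.exp_log hτy] at h4
    · have h1 : A * (T - τ y) ^ (-k) < V := by linarith
      have h2 : A / V < (T - τ y) ^ k := by
        rw [Real.rpow_neg hdy.le, ← div_eq_mul_inv, div_lt_iff₀ (by positivity)] at h1
        rwa [div_lt_iff₀ hVp, mul_comm]
      have h3 := Real.rpow_le_rpow (by positivity) h2.le (by positivity : 0 ≤ 1 / k)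
      rw [← Real.rpow_mul hdy.le, mul_one_div_cancel hk.ne', Real.rpow_one] at h3
      linarith
  have hDc : ContinuousOn D K := by
    intro y hy
    have hy0 := hKne y hy
    have hny : 0 < ‖y‖ := norm_pos_iff.2 hy0
    have hyT : τ y < T := by linarith [hy.2]
    have hb : ContinuousAt (fun y : Euc N => barrier A T k M δ (‖y‖ ^ 2)) y :=
      ContinuousAt.comp (f := fun y : Euc N => ‖y‖ ^ 2)
        (hasDerivAt_barrier (by positivity) hyT).continuousAt
        (continuous_norm.pow 2).continuousAt
    exact (hv.continuousAt.sub
      ((hZ.continuousAt (isOpen_ne.mem_nhds hy0)).add hb)).continuousWithinAt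
  obtain ⟨y, hyK, hymax⟩ := hKcpt.exists_isMaxOn ⟨x, hmem x hx hxT hpos⟩ hDc
  have hy0 := hKne y hyK
  have hyT : τ y < T := by linarith [hyK.2]
  have hDy : 0 < D y := lt_of_lt_of_le hpos (hymax (hmem x hx hxT hpos))
  refine ⟨y, hy0, hyT, hDy, ?_⟩
  filter_upwards [isOpen_ne.mem_nhds hy0, (isOpen_lt hτc continuous_const).mem_nhds hyT] with
    w hw0 hwT
  by_cases hDw : 0 < D w
  · exact hymax (hmem w hw0 hwT hDw)
  · exact (not_lt.1 hDw).trans hDy.le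

/-- Second-order condition for `v - |x|^κ u^σ - barrier` at a local maximum, summed over the
coordinate directions. -/
lemma lap_le_of_isLocalMax {N : ℕ} {u v : Euc N → ℝ} {σ κ μ lam A T k M δ : ℝ}
    (hu : ContDiffOn ℝ 2 u {x : Euc N | x ≠ 0}) (hv : ContDiffOn ℝ 2 v {x : Euc N | x ≠ 0})
    (hu0 : ∀ x, 0 < u x) (hσ : 0 ≤ σ) (hσ1 : σ ≤ 1) (hκ : κ = -((1 - σ) * μ))
    (hμ : 0 ≤ μ) (hμN : μ ≤ N - 2) {x : Euc N} (hx : x ≠ 0) (hxT : (‖x‖ ^ 2) ^ (M / 2) < T)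
    (hmax : IsLocalMax (fun y => v y - (Real.exp (lam + (κ / 2 * Real.log (‖y‖ ^ 2) +
      σ * Real.log (u y))) + barrier A T k M δ (‖y‖ ^ 2))) x) :
    lap v x ≤ Real.exp (lam + (κ / 2 * Real.log (‖x‖ ^ 2) + σ * Real.log (u x))) *
        (σ / u x * lap u x) +
      (4 * ‖x‖ ^ 2 * barrierDeriv₂ A T k M δ (‖x‖ ^ 2) +
        2 * N * barrierDeriv A T k M δ (‖x‖ ^ 2)) := by
  set S : ℝ := ‖x‖ ^ 2 with hS
  have hnx : 0 < ‖x‖ := norm_pos_iff.2 hx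
  have hSp : 0 < S := by positivity
  set z : ℝ := Real.exp (lam + (κ / 2 * Real.log S + σ * Real.log (u x))) with hz
  have hzp : 0 < z := Real.exp_pos _
  set F₁ := barrierDeriv A T k M δ S with hF₁
  set F₂ := barrierDeriv₂ A T k M δ S with hF₂
  have hcoord : ∀ i : Fin N,
      iteratedFDeriv ℝ 2 v x ![EuclideanSpace.single i 1, EuclideanSpace.single i 1] ≤
        z * (κ / S + σ / u x * iteratedFDeriv ℝ 2 u x
            ![EuclideanSpace.single i 1, EuclideanSpace.single i 1] +
          ((1 - σ) * μ ^ 2 - 2 * κ) / S ^ 2 * x i ^ 2) + (4 * F₂ * x i ^ 2 + 2 * F₁) := by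
    intro i
    set e : Euc N := EuclideanSpace.single i 1 with he
    have hV := hasTwoDerivs_line hv hx e
    have hU := hasTwoDerivs_line hu hx e
    have hP := hasTwoDerivs_normSq_line x i
    rw [← he] at hP
    have hP0 : ‖x + (0 : ℝ) • e‖ ^ 2 = S := by simp [hS]
    have hx0 : x + (0 : ℝ) • e = x := by simp
    have hlogP := (hP.log (by rw [hP0]; exact hSp.ne')).const_mul (κ / 2)
    have hlogU := (hU.log (hu0 _).ne').const_mul σ
    have hZ := ((hlogP.add hlogU).const_add lam).exp
    have hnear : ∀ᶠ s in nhds S, 0 < s ∧ s ^ (M / 2) < T := by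
      have hc : ContinuousAt (fun s : ℝ => s ^ (M / 2)) S :=
        Real.continuousAt_rpow_const _ _ (Or.inl hSp.ne')
      exact (lt_mem_nhds hSp).and (hc.eventually (isOpen_Iio.mem_nhds hxT))
    have hB := hP.comp (G := barrier A T k M δ) (G' := barrierDeriv A T k M δ) (c := F₂)
      (by rw [hP0]; filter_upwards [hnear] with s hs using hasDerivAt_barrier hs.1 hs.2)
      (by rw [hP0]; exact hasDerivAt_barrierDeriv hSp hxT)
    have hall := hV.sub (hZ.add hB)
    have hc : Filter.Tendsto (fun t : ℝ => x + t • e) (nhds 0) (nhds x) := by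
      have : Continuous (fun t : ℝ => x + t • e) := by fun_prop
      simpa using this.tendsto 0
    have hm := hall.nonpos_of_isLocalMax (by
      have := hc.eventually hmax
      simpa [IsLocalMax, IsMaxFilter] using this)
    simp only [hx0, ← hS, ← hz] at hm
    have hb := mul_le_mul_of_nonneg_left (power_product_second_deriv_le (x := x i)
      (U₁ := fderiv ℝ u x e) (U₂ := iteratedFDeriv ℝ 2 u x ![e, e]) hSp (hu0 x) hσ hσ1 hκ) hzp.le
    linarith
  have hsum := Finset.sum_le_sum fun i (_ : i ∈ Finset.univ) => hcoord i
  have hnorm : ∑ i, x i ^ 2 = S := (EuclideanSpace.real_norm_sq_eq x).symm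
  simp only [Finset.sum_add_distrib, ← Finset.mul_sum, hnorm, Finset.sum_const,
    Finset.card_univ, Fintype.card_fin, nsmul_eq_mul] at hsum
  have hlap : ∀ f : Euc N → ℝ, lap f x = ∑ i : Fin N,
    iteratedFDeriv ℝ 2 f x ![EuclideanSpace.single i 1, EuclideanSpace.single i 1] := fun _ => rfl
  rw [← hlap, ← hlap] at hsum
  have hneg : z * (N * (κ / S) + ((1 - σ) * μ ^ 2 - 2 * κ) / S ^ 2 * S) ≤ 0 := by
    have h1 : N * (κ / S) + ((1 - σ) * μ ^ 2 - 2 * κ) / S ^ 2 * S =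
        -((1 - σ) * μ * (N - 2 - μ) / S) := by
      rw [hκ]; field_simp; ring
    have h2 : 0 ≤ (1 - σ) * μ * (N - 2 - μ) / S := by
      have h3 : 0 ≤ 1 - σ := by linarith
      have h4 : 0 ≤ (N : ℝ) - 2 - μ := by linarith
      positivity
    rw [h1]
    nlinarith
  linarith

/-- Lemma 2.3 (comparison property): for `N ≥ 2`, `p ≥ q > 0`, `pq > 1`, `a, b > -2` and
`0 ≤ a - b ≤ (N-2)(p-q)`, every positive solution of the Hénon–Lane–Emden system satisfies
`|x|^a v^{p+1} ≤ ((p+1)/(q+1)) |x|^b u^{q+1}` on `ℝ^N \ {0}`. -/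
theorem stmt_16 (N : ℕ) (hN : 2 ≤ N) (p q a b : ℝ)
    (hq : 0 < q) (hqp : q ≤ p) (hpq : 1 < p * q)
    (ha : -2 < a) (hb : -2 < b)
    (hab : 0 ≤ a - b ∧ a - b ≤ ((N : ℝ) - 2) * (p - q))
    (u v : Euc N → ℝ) (hsol : IsHLESol p q a b u v)
    (hu : ∀ x, 0 < u x) (hv : ∀ x, 0 < v x) :
    ∀ x : Euc N, x ≠ 0 →
      ‖x‖ ^ a * v x ^ (p + 1) ≤ ((p + 1) / (q + 1)) * (‖x‖ ^ b * u x ^ (q + 1)) := by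
  obtain ⟨hu2, hv2, huc, hvc, hequ, heqv⟩ := hsol
  have hp : 0 < p := lt_of_lt_of_le hq hqp
  have hN2 : (2 : ℝ) ≤ N := by exact_mod_cast hN
  obtain ⟨σ, hσ⟩ : ∃ σ, σ = (q + 1) / (p + 1) := ⟨_, rfl⟩
  obtain ⟨κ, hκ⟩ : ∃ κ, κ = (b - a) / (p + 1) := ⟨_, rfl⟩
  obtain ⟨lam, hlam⟩ : ∃ lam, lam = -Real.log σ / (p + 1) := ⟨_, rfl⟩
  have hσp : 0 < σ := by rw [hσ]; positivity
  have hσ1 : σ ≤ 1 := by rw [hσ, div_le_one (by linarith)]; linarith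
  obtain ⟨μ, hκμ, hμ, hμN⟩ : ∃ μ, κ = -((1 - σ) * μ) ∧ 0 ≤ μ ∧ μ ≤ (N : ℝ) - 2 := by
    rcases hqp.eq_or_lt with h | h
    · refine ⟨0, ?_, le_rfl, by linarith⟩
      have : b - a = 0 := by
        have h1 := hab.2
        rw [h, sub_self, mul_zero] at h1
        linarith [hab.1]
      simp [hκ, this]
    · have hpq' : 0 < p - q := sub_pos.2 h
      refine ⟨(a - b) / (p - q), ?_, div_nonneg hab.1 hpq'.le, ?_⟩
      · rw [hκ, hσ]; field_simp; ring
      · rw [div_le_iff₀ hpq']; exact hab.2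
  have hinv : 1 / σ = (p + 1) / (q + 1) := by rw [hσ]; field_simp
  obtain ⟨e, he⟩ : ∃ e, e = p - 1 / σ := ⟨_, rfl⟩
  have hep : 0 < e := by
    rw [he, hinv, sub_pos, div_lt_iff₀ (by linarith)]; nlinarith
  obtain ⟨M, hM⟩ : ∃ M, M = κ / σ + a + 2 := ⟨_, rfl⟩
  have hMp : 0 < M := by
    have : M = ((b + 2) + q * (a + 2)) / (q + 1) := by
      rw [hM, hκ, hσ]; field_simp; ring
    rw [this]
    have h1 : 0 < b + 2 := by linarith
    have h2 : 0 < a + 2 := by linarith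
    positivity
  obtain ⟨k, hk⟩ : ∃ k, k = 2 / e := ⟨_, rfl⟩
  have hkp : 0 < k := by rw [hk]; positivity
  obtain ⟨C, hC⟩ : ∃ C, C = σ * Real.exp (lam / σ) := ⟨_, rfl⟩
  have hCp : 0 < C := by rw [hC]; positivity
  obtain ⟨L, hL⟩ : ∃ L, L = k * (M ^ 2 * (k + 1) + M * (M + N - 2)) := ⟨_, rfl⟩
  have hLp : 0 < L := by
    have : 0 < M + N - 2 := by linarith
    rw [hL]; positivity
  set Z : Euc N → ℝ := fun y =>
    Real.exp (lam + (κ / 2 * Real.log (‖y‖ ^ 2) + σ * Real.log (u y))) with hZ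
  have hZc : ContinuousOn Z {x : Euc N | x ≠ 0} := by
    intro y hy
    have hy' : ‖y‖ ^ 2 ≠ 0 := pow_ne_zero _ (norm_ne_zero_iff.2 hy)
    have h1 : ContinuousAt (fun y : Euc N => Real.log (‖y‖ ^ 2)) y :=
      (continuous_norm.pow 2).continuousAt.log hy'
    have h2 : ContinuousAt (fun y : Euc N => Real.log (u y)) y := huc.continuousAt.log (hu y).ne'
    exact (Real.continuous_exp.continuousAt.comp ((continuousAt_const (y := lam)).add
      ((continuousAt_const.mul h1).add (continuousAt_const.mul h2)))).continuousWithinAt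
  have hkey : ∀ x : Euc N, x ≠ 0 → v x ≤ Z x := by
    intro x hx
    by_contra! hlt
    have hnx : 0 < ‖x‖ := norm_pos_iff.2 hx
    obtain ⟨T, A, δ, htT, hA, hδ, hAe, hsmall⟩ := exists_barrier_params
      (t := (‖x‖ ^ 2) ^ (M / 2)) (by positivity) (sub_pos.2 hlt) (div_pos hLp hCp) hep
    have hpos : 0 < v x - (Z x + barrier A T k M δ (‖x‖ ^ 2)) := by
      rw [← hk, Real.log_rpow (by positivity)] at hsmall
      unfold barrier
      linarith
    obtain ⟨y, hy, hyT, hypos, hymax⟩ := exists_isLocalMax_sub_barrier hvc hZc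
      (fun _ => Real.exp_pos _) hA hkp hMp hδ hx htT hpos
    have hlap := lap_le_of_isLocalMax hu2 hv2 hu hσp.le hσ1 hκμ hμ hμN hy hyT hymax
    have hny : 0 < ‖y‖ := norm_pos_iff.2 hy
    have hS : 0 < ‖y‖ ^ 2 := by positivity
    have hbar := barrier_laplacian_le hN2 hA hkp hMp hδ hS hyT
    have hd : 0 < T - (‖y‖ ^ 2) ^ (M / 2) := sub_pos.2 hyT
    obtain ⟨f, hf⟩ : ∃ f, f = A * (T - (‖y‖ ^ 2) ^ (M / 2)) ^ (-k) := ⟨_, rfl⟩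
    have hfp : 0 < f := by rw [hf]; positivity
    have hvf : Z y + f < v y := by
      have hlog : 0 < δ * (Real.log T - M / 2 * Real.log (‖y‖ ^ 2)) := by
        rw [← Real.log_rpow hS]
        exact mul_pos hδ (sub_pos.2 (Real.log_lt_log (by positivity) hyT))
      unfold barrier at hypos
      rw [← hf] at hypos
      linarith
    have hnl := nonlinearity_lower_bound hq hqp hpq hny (hu y) hfp hσ hκ hlam rfl hvf
    have hfe : f ^ (1 + (p - 1 / σ)) =
        L / C * T * (A * (T - (‖y‖ ^ 2) ^ (M / 2)) ^ (-k - 2)) := by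
      have hke : -k * (1 + e) = -k - 2 := by rw [hk]; field_simp; ring
      rw [← he, hf, Real.mul_rpow hA.le (by positivity), ← Real.rpow_mul hd.le, hke,
        Real.rpow_add hA, Real.rpow_one, hAe]
      ring
    have hrm : (‖y‖ ^ 2) ^ (M / 2 - 1) = ‖y‖ ^ (κ / σ + a) := by
      rw [← Real.rpow_natCast, ← Real.rpow_mul hny.le, hM]
      congr 1
      push_cast
      ring
    have habs : ∀ s w : ℝ, 0 < w → |w| ^ (s - 1) * w = w ^ s := fun s w hw => by
      rw [abs_of_pos hw, ← Real.rpow_add_one hw.ne', sub_add_cancel]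
    have h1 := hequ y hy
    have h2 := heqv y hy
    rw [habs p _ (hv y)] at h1
    rw [habs q _ (hu y)] at h2
    have h3 : lap u y = -(‖y‖ ^ a * v y ^ p) := by linarith
    have h4 : lap v y = -(‖y‖ ^ b * u y ^ q) := by linarith
    rw [h3, h4] at hlap
    rw [hfe, ← hC] at hnl
    rw [hrm, ← hL] at hbar
    have h5 : C * ‖y‖ ^ (κ / σ + a) *
        (L / C * T * (A * (T - (‖y‖ ^ 2) ^ (M / 2)) ^ (-k - 2))) =
        ‖y‖ ^ (κ / σ + a) * (L * T * (A * (T - (‖y‖ ^ 2) ^ (M / 2)) ^ (-k - 2))) := by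
      field_simp
    rw [h5] at hnl
    linarith
  intro x hx
  have hnx : 0 < ‖x‖ := norm_pos_iff.2 hx
  have hlogv := Real.log_le_log (hv x) (hkey x hx)
  rw [hZ] at hlogv
  dsimp only at hlogv
  rw [Real.log_exp, Real.log_pow] at hlogv
  rw [← Real.log_le_log_iff (by have := hv x; positivity) (by have := hu x; positivity),
    Real.log_mul (by positivity) (Real.rpow_pos_of_pos (hv x) _).ne',
    Real.log_mul (by positivity) (mul_pos (by positivity) (Real.rpow_pos_of_pos (hu x) _)).ne',
    Real.log_mul (by positivity) (Real.rpow_pos_of_pos (hu x) _).ne',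
    Real.log_rpow hnx, Real.log_rpow (hv x), Real.log_rpow hnx, Real.log_rpow (hu x)]
  have h1 : Real.log ((p + 1) / (q + 1)) = lam * (p + 1) := by
    rw [← hinv, one_div, Real.log_inv, hlam]; field_simp
  have h2 : κ * (p + 1) = b - a := by rw [hκ]; field_simp
  have h3 : σ * (p + 1) = q + 1 := by rw [hσ]; field_simp
  have h4 := mul_le_mul_of_nonneg_left hlogv (by linarith : 0 ≤ p + 1)
  push_cast at h4
  rw [h1, ← h3]
  have h5 : (p + 1) * (lam + (κ / 2 * (2 * Real.log ‖x‖) + σ * Real.log (u x))) =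
      lam * (p + 1) + (b - a) * Real.log ‖x‖ + σ * (p + 1) * Real.log (u x) := by
    rw [← h2]; ring
  rw [h5] at h4
  linarith
end
end
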